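/- Let Σ ⊂ ℝ^{n+1} be a complete minimal hypersurface whose Gauss map image lies in a geodesic ball B_Λ(y₀) ⊂ S^n with Λ < π/2 (i.e. in a compact subset of an open hemisphere). Then Σ is a hyperplane. -/

import Mathlib

open scoped BigOperators RealInnerProductSpace
open Real

noncomputable section

/-- Partial derivative (in the `i`-th chart direction) of a vector-valued map on ℝⁿ. -/
def pdv {n m : ℕ} (i : Fin n) (f : (Fin n → ℝ) → EuclideanSpace ℝ (Fin m))
    (x : Fin n → ℝ) : EuclideanSpace ℝ (Fin m) :=
  fderiv ℝ f x (Pi.single i 1)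

/-- Partial derivative of a scalar function on ℝⁿ. -/
def pdr {n : ℕ} (i : Fin n) (f : (Fin n → ℝ) → ℝ) (x : Fin n → ℝ) : ℝ :=
  fderiv ℝ f x (Pi.single i 1)

/-- Induced metric g_{ij} = ⟪∂_i F, ∂_j F⟫ of an immersion F. -/
def gmet {n : ℕ} (F : (Fin n → ℝ) → EuclideanSpace ℝ (Fin (n + 1)))
    (x : Fin n → ℝ) : Matrix (Fin n) (Fin n) ℝ :=
  Matrix.of fun i j => ⟪pdv i F x, pdv j F x⟫

/-- Second fundamental form h_{ij} w.r.t. the outer unit normal ν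
(convention: positive for convex hypersurfaces with outer normal). -/
def sff {n : ℕ} (F : (Fin n → ℝ) → EuclideanSpace ℝ (Fin (n + 1)))
    (ν : (Fin n → ℝ) → EuclideanSpace ℝ (Fin (n + 1)))
    (x : Fin n → ℝ) (i j : Fin n) : ℝ :=
  -⟪pdv i (fun y => pdv j F y) x, ν x⟫

/-- Mean curvature H = g^{ij} h_{ij}. -/
def meanCurv {n : ℕ} (F ν : (Fin n → ℝ) → EuclideanSpace ℝ (Fin (n + 1)))
    (x : Fin n → ℝ) : ℝ :=
  ∑ i, ∑ j, (gmet F x)⁻¹ i j * sff F ν x i j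

/-- Christoffel symbols Γ^k_{ij} of the induced metric. -/
def chr {n : ℕ} (F : (Fin n → ℝ) → EuclideanSpace ℝ (Fin (n + 1)))
    (x : Fin n → ℝ) (k i j : Fin n) : ℝ :=
  ∑ l, (gmet F x)⁻¹ k l * ⟪pdv i (fun y => pdv j F y) x, pdv l F x⟫

/-- Scalar Laplace–Beltrami operator of the induced metric. -/
def lapS {n : ℕ} (F : (Fin n → ℝ) → EuclideanSpace ℝ (Fin (n + 1)))
    (f : (Fin n → ℝ) → ℝ) (x : Fin n → ℝ) : ℝ :=
  ∑ i, ∑ j, (gmet F x)⁻¹ i j *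
    (pdr i (fun y => pdr j f y) x - ∑ k, chr F x k i j * pdr k f x)

/-- Componentwise Laplace–Beltrami operator on ℝ^{n+1}-valued maps. -/
def lapV {n : ℕ} (F : (Fin n → ℝ) → EuclideanSpace ℝ (Fin (n + 1)))
    (f : (Fin n → ℝ) → EuclideanSpace ℝ (Fin (n + 1)))
    (x : Fin n → ℝ) : EuclideanSpace ℝ (Fin (n + 1)) :=
  ∑ i, ∑ j, (gmet F x)⁻¹ i j •
    (pdv i (fun y => pdv j f y) x - ∑ k, chr F x k i j • pdv k f x)

/-- Energy density |∇u|² = g^{ij}⟪∂_i u, ∂_j u⟫ of the Gauss map u = ν. -/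
def eDen {n : ℕ} (F ν : (Fin n → ℝ) → EuclideanSpace ℝ (Fin (n + 1)))
    (x : Fin n → ℝ) : ℝ :=
  ∑ i, ∑ j, (gmet F x)⁻¹ i j * ⟪pdv i ν x, pdv j ν x⟫


/-- Induced Riemannian distance on Σ: infimum of lengths of C¹ paths. -/
def indDist {n : ℕ} (F : (Fin n → ℝ) → EuclideanSpace ℝ (Fin (n + 1)))
    (x y : Fin n → ℝ) : ℝ :=
  sInf {L | ∃ γ : ℝ → Fin n → ℝ, ContDiff ℝ 1 γ ∧ γ 0 = x ∧ γ 1 = y ∧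
    L = ∫ t in (0:ℝ)..1, ‖fderiv ℝ (F ∘ γ) t 1‖}

section Simons

variable {R ι : Type*} [CommRing R] [Algebra ℝ R] [Fintype ι]

/-- The sum of squares of a family of derivations. -/
def derLap (δ : ι → Derivation ℝ R R) (φ : R) : R := ∑ a, δ a (δ a φ)

/-- `|A|²`, expressed through the tangential derivatives of the normal. -/
def derSq (δ : ι → Derivation ℝ R R) (ν : ι → R) : R := ∑ a, ∑ b, δ a (ν b) * δ a (ν b)

/-- The relations satisfied by the tangential derivatives `δ` along a minimal hypersurface with
unit normal `ν`. -/
structure IsMinimalCalculus (δ : ι → Derivation ℝ R R) (ν : ι → R) : Prop where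
  tangent : ∀ φ, ∑ a, ν a * δ a φ = 0
  symm : ∀ a b, δ a (ν b) = δ b (ν a)
  trace : ∑ a, δ a (ν a) = 0
  comm : ∀ a b φ, δ a (δ b φ) =
    δ b (δ a φ) + ∑ c, (ν a * δ b (ν c) - ν b * δ a (ν c)) * δ c φ

variable {δ : ι → Derivation ℝ R R} {ν : ι → R}

theorem IsMinimalCalculus.normal (H : IsMinimalCalculus δ ν) (a : ι) :
    ∑ b, ν b * δ a (ν b) = 0 := by
  simpa only [H.symm a] using H.tangent (ν a)

theorem IsMinimalCalculus.derLap_normal (H : IsMinimalCalculus δ ν) (b : ι) :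
    derLap δ (ν b) = -(derSq δ ν * ν b) := by
  have h1 : ∀ a, δ a (δ a (ν b)) = δ b (δ a (ν a)) +
      ∑ c, (ν a * δ b (ν c) - ν b * δ a (ν c)) * δ c (ν a) := fun a => by
    rw [H.symm a b, H.comm a b]
  have h2 : ∑ a, ∑ c, ν a * δ b (ν c) * δ c (ν a) = 0 := by
    rw [Finset.sum_comm]
    refine Finset.sum_eq_zero fun c _ => ?_
    have := congrArg (δ b (ν c) * ·) (H.normal c)
    simp only [Finset.mul_sum, mul_zero] at this
    rw [← this]
    exact Finset.sum_congr rfl fun a _ => by ring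
  have h3 : ∑ a, ∑ c, ν b * δ a (ν c) * δ c (ν a) = derSq δ ν * ν b := by
    simp only [derSq, Finset.sum_mul]
    refine Finset.sum_congr rfl fun a _ => Finset.sum_congr rfl fun c _ => ?_
    rw [H.symm c a]; ring
  simp only [derLap, h1, Finset.sum_add_distrib, sub_mul, Finset.sum_sub_distrib, h2, h3,
    ← map_sum, H.trace, map_zero]
  ring

theorem IsMinimalCalculus.normal_mul_der (H : IsMinimalCalculus δ ν) (d c : ι) :
    ∑ a, ν a * δ d (δ a (ν c)) = -∑ a, δ d (ν a) * δ a (ν c) := by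
  have := congrArg (δ d) (H.normal c)
  simp only [map_sum, Derivation.leibniz, smul_eq_mul, map_zero, Finset.sum_add_distrib] at this
  rw [← sub_eq_zero, sub_neg_eq_add, ← this]
  congr 1 <;> refine Finset.sum_congr rfl fun a _ => ?_
  · rw [H.symm a c]
  · rw [H.symm a c]; ring

theorem IsMinimalCalculus.derLap_der (H : IsMinimalCalculus δ ν) :
    ∃ X Y : ι → R, ∀ b c, derLap δ (δ b (ν c)) = -(derSq δ ν * δ b (ν c)) -
      2 * (∑ a, ∑ d, δ b (ν d) * δ d (ν a) * δ a (ν c)) + ν c * X b + ν b * Y c := by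
  refine ⟨fun b => - δ b (derSq δ ν), fun c => - (∑ a, ∑ d, δ a (ν d) * δ d (δ a (ν c)))
    - ∑ a, δ a (∑ d, δ a (ν d) * δ d (ν c)), fun b c => ?_⟩
  have h1 : ∀ a, δ a (δ a (δ b (ν c))) = δ b (δ a (δ a (ν c))) +
      ∑ d, (ν a * δ b (ν d) - ν b * δ a (ν d)) * δ d (δ a (ν c)) +
      δ a (ν a * (∑ d, δ b (ν d) * δ d (ν c)) - ν b * (∑ d, δ a (ν d) * δ d (ν c))) := by
    intro a
    rw [H.comm a b (ν c), map_add, H.comm a b]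
    congr 2
    simp only [Finset.mul_sum, ← Finset.sum_sub_distrib]
    exact Finset.sum_congr rfl fun d _ => by ring
  have h2 : ∑ a, δ b (δ a (δ a (ν c))) =
      -(derSq δ ν * δ b (ν c)) - ν c * δ b (derSq δ ν) := by
    rw [← map_sum]
    change δ b (derLap δ (ν c)) = _
    rw [H.derLap_normal, map_neg, Derivation.leibniz, smul_eq_mul, smul_eq_mul]
    ring
  have h3 : ∑ a, ∑ d, ν a * δ b (ν d) * δ d (δ a (ν c)) =
      - ∑ a, ∑ d, δ b (ν d) * δ d (ν a) * δ a (ν c) := by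
    rw [Finset.sum_comm, Finset.sum_comm (f := fun a d => δ b (ν d) * δ d (ν a) * δ a (ν c)),
      ← Finset.sum_neg_distrib]
    refine Finset.sum_congr rfl fun d _ => ?_
    have := congrArg (δ b (ν d) * ·) (H.normal_mul_der d c)
    simp only [Finset.mul_sum, mul_neg] at this
    calc _ = ∑ a, δ b (ν d) * (ν a * δ d (δ a (ν c))) :=
          Finset.sum_congr rfl fun a _ => by ring
      _ = _ := by rw [this]; simp only [mul_assoc]
  have h4 : ∑ a, ∑ d, ν b * δ a (ν d) * δ d (δ a (ν c)) =
      ν b * ∑ a, ∑ d, δ a (ν d) * δ d (δ a (ν c)) := by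
    simp only [Finset.mul_sum, mul_assoc]
  have h5 : ∑ a, δ a (ν a * (∑ d, δ b (ν d) * δ d (ν c))) = 0 := by
    simp only [Derivation.leibniz, smul_eq_mul, Finset.sum_add_distrib, H.tangent, zero_add,
      ← Finset.mul_sum, H.trace, mul_zero]
  have h6 : ∑ a, δ a (ν b * (∑ d, δ a (ν d) * δ d (ν c))) =
      (∑ a, ∑ d, δ b (ν d) * δ d (ν a) * δ a (ν c)) +
      ν b * ∑ a, δ a (∑ d, δ a (ν d) * δ d (ν c)) := by
    simp only [Derivation.leibniz (δ _) (ν b), smul_eq_mul, Finset.sum_add_distrib,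
      ← Finset.mul_sum]
    rw [add_comm]
    congr 1
    rw [Finset.sum_comm]
    simp only [Finset.sum_mul]
    refine Finset.sum_congr rfl fun a _ => Finset.sum_congr rfl fun d _ => ?_
    rw [H.symm b a]; ring
  simp only [derLap] at *
  simp only [h1, Finset.sum_add_distrib, sub_mul, map_sub, Finset.sum_sub_distrib, h2, h3, h4, h5,
    h6]
  ring


/-- The square of the second fundamental form. -/
def derShapeSq (δ : ι → Derivation ℝ R R) (ν : ι → R) (a b : ι) : R :=
  ∑ e, δ a (ν e) * δ e (ν b)

/-- The covariant derivative of the second fundamental form. -/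
def derCovShape (δ : ι → Derivation ℝ R R) (ν : ι → R) (a b c : ι) : R :=
  δ a (δ b (ν c)) + ν b * derShapeSq δ ν a c + ν c * derShapeSq δ ν a b

theorem IsMinimalCalculus.normal_derShapeSq (H : IsMinimalCalculus δ ν) (a : ι) :
    ∑ b, ν b * derShapeSq δ ν a b = 0 := by
  simp only [derShapeSq, Finset.mul_sum]
  rw [Finset.sum_comm]
  refine Finset.sum_eq_zero fun e _ => ?_
  have := congrArg (δ a (ν e) * ·) (H.normal e)
  simp only [Finset.mul_sum, mul_zero] at this
  rw [← this]
  exact Finset.sum_congr rfl fun b _ => by ring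

theorem IsMinimalCalculus.der_derSq (H : IsMinimalCalculus δ ν) (a : ι) :
    δ a (derSq δ ν) = 2 * ∑ b, ∑ c, δ b (ν c) * derCovShape δ ν a b c := by
  have h1 : ∑ b, ∑ c, δ b (ν c) * (ν b * derShapeSq δ ν a c) = 0 := by
    rw [Finset.sum_comm]
    refine Finset.sum_eq_zero fun c _ => ?_
    have := congrArg (derShapeSq δ ν a c * ·) (H.tangent (ν c))
    simp only [Finset.mul_sum, mul_zero] at this
    rw [← this]
    exact Finset.sum_congr rfl fun b _ => by ring
  have h2 : ∑ b, ∑ c, δ b (ν c) * (ν c * derShapeSq δ ν a b) = 0 := by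
    refine Finset.sum_eq_zero fun c _ => ?_
    have := congrArg (derShapeSq δ ν a c * ·) (H.normal c)
    simp only [Finset.mul_sum, mul_zero] at this
    rw [← this]
    exact Finset.sum_congr rfl fun b _ => by ring
  simp only [derCovShape, mul_add, Finset.sum_add_distrib, h1, h2, derSq, map_sum,
    Derivation.leibniz, smul_eq_mul]
  simp only [two_mul, add_zero]

theorem IsMinimalCalculus.sum_derCovShape_sq (H : IsMinimalCalculus δ ν)
    (hν : ∑ a, ν a * ν a = 1) :
    ∑ a, ∑ b, ∑ c, derCovShape δ ν a b c * derCovShape δ ν a b c =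
      (∑ a, ∑ b, ∑ c, δ a (δ b (ν c)) * δ a (δ b (ν c))) -
        2 * ∑ a, ∑ b, derShapeSq δ ν a b * derShapeSq δ ν a b := by
  rw [Finset.mul_sum, ← Finset.sum_sub_distrib]
  refine Finset.sum_congr rfl fun a _ => ?_
  have e1 : ∑ b, ∑ c, δ a (δ b (ν c)) * (ν b * derShapeSq δ ν a c) =
      - ∑ c, derShapeSq δ ν a c * derShapeSq δ ν a c := by
    rw [Finset.sum_comm, ← Finset.sum_neg_distrib]
    refine Finset.sum_congr rfl fun c _ => ?_
    have := congrArg (derShapeSq δ ν a c * ·) (H.normal_mul_der a c)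
    simp only [Finset.mul_sum] at this
    rw [← mul_neg]
    refine Eq.trans ?_ this
    exact Finset.sum_congr rfl fun b _ => by ring
  have e2 : ∑ b, ∑ c, δ a (δ b (ν c)) * (ν c * derShapeSq δ ν a b) =
      - ∑ c, derShapeSq δ ν a c * derShapeSq δ ν a c := by
    rw [Finset.sum_comm, ← e1]
    refine Finset.sum_congr rfl fun c _ => Finset.sum_congr rfl fun b _ => ?_
    rw [H.symm c b]
  have e3 : ∑ b, ∑ c, (ν b * derShapeSq δ ν a c) * (ν c * derShapeSq δ ν a b) = 0 := by
    have := congrArg₂ (· * ·) (H.normal_derShapeSq a) (H.normal_derShapeSq a)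
    simp only [Finset.sum_mul_sum, mul_zero] at this
    rw [← this]
    exact Finset.sum_congr rfl fun b _ => Finset.sum_congr rfl fun c _ => by ring
  have e4 : ∑ b, ∑ c, (ν b * derShapeSq δ ν a c) * (ν b * derShapeSq δ ν a c) =
      ∑ c, derShapeSq δ ν a c * derShapeSq δ ν a c := by
    rw [← one_mul (∑ c, derShapeSq δ ν a c * derShapeSq δ ν a c), ← hν, Finset.sum_mul_sum]
    exact Finset.sum_congr rfl fun b _ => Finset.sum_congr rfl fun c _ => by ring
  have e5 : ∑ b, ∑ c, (ν c * derShapeSq δ ν a b) * (ν c * derShapeSq δ ν a b) =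
      ∑ c, derShapeSq δ ν a c * derShapeSq δ ν a c := by
    rw [Finset.sum_comm, e4]
  have e6 : ∀ b c, derCovShape δ ν a b c * derCovShape δ ν a b c =
      δ a (δ b (ν c)) * δ a (δ b (ν c)) +
      ((ν b * derShapeSq δ ν a c) * (ν b * derShapeSq δ ν a c) +
      (ν c * derShapeSq δ ν a b) * (ν c * derShapeSq δ ν a b)) +
      2 * (δ a (δ b (ν c)) * (ν b * derShapeSq δ ν a c) +
      δ a (δ b (ν c)) * (ν c * derShapeSq δ ν a b) +
      (ν b * derShapeSq δ ν a c) * (ν c * derShapeSq δ ν a b)) := fun b c => by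
    rw [derCovShape]; ring
  simp only [e6, Finset.sum_add_distrib, ← Finset.mul_sum, e1, e2, e3, e4, e5]
  ring

/-- Simons' identity. -/
theorem IsMinimalCalculus.derLap_derSq (H : IsMinimalCalculus δ ν)
    (hν : ∑ a, ν a * ν a = 1) :
    derLap δ (derSq δ ν) = 2 * (∑ a, ∑ b, ∑ c, derCovShape δ ν a b c * derCovShape δ ν a b c) -
      2 * (derSq δ ν * derSq δ ν) := by
  have h0 : derLap δ (derSq δ ν) = 2 * (∑ b, ∑ c, δ b (ν c) * derLap δ (δ b (ν c))) +
      2 * ∑ a, ∑ b, ∑ c, δ a (δ b (ν c)) * δ a (δ b (ν c)) := by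
    have h1 : ∑ b, ∑ c, δ b (ν c) * derLap δ (δ b (ν c)) =
        ∑ a, ∑ b, ∑ c, δ b (ν c) * δ a (δ a (δ b (ν c))) := by
      simp only [derLap, Finset.mul_sum]
      rw [Finset.sum_comm (s := (Finset.univ : Finset ι)) (t := (Finset.univ : Finset ι))
        (f := fun a b => ∑ c, δ b (ν c) * δ a (δ a (δ b (ν c))))]
      exact Finset.sum_congr rfl fun b _ => Finset.sum_comm
    rw [h1]
    simp only [derLap, derSq, Finset.mul_sum, ← Finset.sum_add_distrib, map_sum,
      Derivation.leibniz, smul_eq_mul, map_add]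
    exact Finset.sum_congr rfl fun a _ => Finset.sum_congr rfl fun b _ =>
      Finset.sum_congr rfl fun c _ => by ring
  obtain ⟨X, Y, hXY⟩ := H.derLap_der
  have hX : ∑ b, ∑ c, δ b (ν c) * (ν c * X b) = 0 := by
    refine Finset.sum_eq_zero fun b _ => ?_
    have := congrArg (X b * ·) (H.normal b)
    simp only [Finset.mul_sum, mul_zero] at this
    rw [← this]
    exact Finset.sum_congr rfl fun b _ => by ring
  have hY : ∑ b, ∑ c, δ b (ν c) * (ν b * Y c) = 0 := by
    rw [Finset.sum_comm]
    refine Finset.sum_eq_zero fun c _ => ?_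
    have := congrArg (Y c * ·) (H.tangent (ν c))
    simp only [Finset.mul_sum, mul_zero] at this
    rw [← this]
    exact Finset.sum_congr rfl fun b _ => by ring
  have hk : ∑ b, ∑ c, δ b (ν c) * (∑ a, ∑ d, δ b (ν d) * δ d (ν a) * δ a (ν c)) =
      ∑ a, ∑ b, derShapeSq δ ν a b * derShapeSq δ ν a b := by
    refine Finset.sum_congr rfl fun b _ => ?_
    simp only [derShapeSq]
    have : ∀ a, (∑ e, δ b (ν e) * δ e (ν a)) * (∑ e, δ b (ν e) * δ e (ν a)) =
        ∑ c, δ b (ν c) * ∑ d, δ b (ν d) * δ d (ν a) * δ a (ν c) := fun a => by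
      rw [Finset.sum_mul]
      refine Finset.sum_congr rfl fun c _ => ?_
      simp only [Finset.mul_sum]
      refine Finset.sum_congr rfl fun d _ => ?_
      rw [H.symm a c]; ring
    simp only [this]
    rw [Finset.sum_comm]
    simp only [Finset.mul_sum]
  have hc : ∑ b, ∑ c, δ b (ν c) * (derSq δ ν * δ b (ν c)) = derSq δ ν * derSq δ ν := by
    conv_rhs => arg 2; rw [derSq]
    simp only [Finset.mul_sum]
    exact Finset.sum_congr rfl fun b _ => Finset.sum_congr rfl fun c _ => by ring
  rw [h0, H.sum_derCovShape_sq hν]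
  have h2 : ∀ b c, δ b (ν c) * derLap δ (δ b (ν c)) = - (δ b (ν c) * (derSq δ ν * δ b (ν c))) -
      2 * (δ b (ν c) * (∑ a, ∑ d, δ b (ν d) * δ d (ν a) * δ a (ν c))) +
      δ b (ν c) * (ν c * X b) + δ b (ν c) * (ν b * Y c) := fun b c => by rw [hXY]; ring
  simp only [h2, Finset.sum_add_distrib, Finset.sum_sub_distrib, hX, hY, ← Finset.mul_sum, hk, hc,
    Finset.sum_neg_distrib]
  ring

end Simons

section Frame

variable {R ι κ : Type*} [CommRing R] [Algebra ℝ R] [Fintype κ]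

/-- The tangential derivatives of a frame. -/
def tangDer (d : κ → Derivation ℝ R R) (F : ι → R) (G : κ → κ → R) (a : ι) : Derivation ℝ R R :=
  ∑ j, (∑ i, G i j * d i (F a)) • d j

theorem tangDer_apply {d : κ → Derivation ℝ R R} {F : ι → R} {G : κ → κ → R} (a : ι) (φ : R) :
    tangDer d F G a φ = ∑ j, (∑ i, G i j * d i (F a)) * d j φ := by
  have : ∀ s : Finset κ, (∑ j ∈ s, (∑ i, G i j * d i (F a)) • d j) φ =
      ∑ j ∈ s, (∑ i, G i j * d i (F a)) * d j φ := fun s => by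
    classical
    induction s using Finset.induction_on with
    | empty => simp
    | insert j s hj ih => rw [Finset.sum_insert hj, Finset.sum_insert hj, Derivation.add_apply, ih,
        Derivation.smul_apply, smul_eq_mul]
  exact this _

variable [Fintype ι] [DecidableEq ι] [DecidableEq κ]

/-- Data of a minimal hypersurface over a ring with commuting derivations: position `F`,
unit normal `ν`, inverse metric `G`. -/
structure IsMinimalFrame (d : κ → Derivation ℝ R R) (F ν : ι → R) (G : κ → κ → R) : Prop where
  d_comm : ∀ i j φ, d i (d j φ) = d j (d i φ)
  inv : ∀ k l, ∑ i, G i k * ∑ a, d i (F a) * d l (F a) = if k = l then 1 else 0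
  unit : ∑ a, ν a * ν a = 1
  orth : ∀ i, ∑ a, ν a * d i (F a) = 0
  proj : ∀ a b, ∑ j, (∑ i, G i j * d i (F a)) * d j (F b) = (if a = b then 1 else 0) - ν a * ν b
  mean : ∑ j, ∑ i, G i j * ∑ a, d i (F a) * d j (ν a) = 0

variable {d : κ → Derivation ℝ R R} {F ν : ι → R} {G : κ → κ → R}

theorem IsMinimalFrame.tangDer_pos (H : IsMinimalFrame d F ν G) (a b : ι) :
    tangDer d F G a (F b) = (if a = b then 1 else 0) - ν a * ν b := by
  rw [tangDer_apply, H.proj]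

theorem IsMinimalFrame.normal_der (H : IsMinimalFrame d F ν G) (j : κ) :
    ∑ a, ν a * d j (ν a) = 0 := by
  have h := congrArg (d j) H.unit
  simp only [map_sum, Derivation.leibniz, smul_eq_mul, Finset.sum_add_distrib,
    Derivation.map_one_eq_zero] at h
  rw [← two_mul] at h
  have h2 := congrArg (algebraMap ℝ R (1/2) * ·) h
  simp only [mul_zero] at h2
  rw [← h2, ← mul_assoc, ← map_ofNat (algebraMap ℝ R) 2, ← map_mul]
  norm_num

theorem IsMinimalFrame.eq_zero (H : IsMinimalFrame d F ν G) (Y : κ → R)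
    (hY : ∀ a, ∑ j, Y j * d j (F a) = 0) (k : κ) : Y k = 0 := by
  have h : ∑ j, (∑ i, G i k * ∑ a, d i (F a) * d j (F a)) * Y j = 0 := by
    have : ∀ i a, G i k * d i (F a) * ∑ j, Y j * d j (F a) = 0 := fun i a => by rw [hY, mul_zero]
    calc _ = ∑ i, ∑ a, G i k * d i (F a) * ∑ j, Y j * d j (F a) := by
          simp only [Finset.mul_sum, Finset.sum_mul]
          rw [Finset.sum_comm]
          refine Finset.sum_congr rfl fun i _ => ?_
          rw [Finset.sum_comm]
          exact Finset.sum_congr rfl fun a _ => Finset.sum_congr rfl fun j _ => by ring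
      _ = 0 := by simp only [this, Finset.sum_const_zero]
  simpa [H.inv] using h

theorem IsMinimalFrame.isMinimalCalculus (H : IsMinimalFrame d F ν G) :
    IsMinimalCalculus (tangDer d F G) ν := by
  have hs : ∀ k j, ∑ c, d k (F c) * d j (ν c) = ∑ c, d j (F c) * d k (ν c) := fun k j => by
    have h : ∀ k j, ∑ c, d k (F c) * d j (ν c) = - ∑ c, ν c * d j (d k (F c)) := fun k j => by
      have := congrArg (d j) (H.orth k)
      simp only [map_sum, Derivation.leibniz, smul_eq_mul, Finset.sum_add_distrib, map_zero] at this
      exact eq_neg_of_add_eq_zero_right this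
    rw [h, h]
    exact congrArg _ (Finset.sum_congr rfl fun c _ => by rw [H.d_comm])
  have hν : ∀ j b, d j (ν b) =
      ∑ k, (∑ i, G i k * d i (F b)) * ∑ c, d k (F c) * d j (ν c) := fun j b => by
    calc d j (ν b) = ∑ c, ((if b = c then 1 else 0) - ν b * ν c) * d j (ν c) := by
          have := H.normal_der j
          simp only [sub_mul, Finset.sum_sub_distrib, mul_assoc, ← Finset.mul_sum, this]
          simp
      _ = _ := by
          simp only [← H.proj, Finset.sum_mul]
          rw [Finset.sum_comm]
          refine Finset.sum_congr rfl fun k _ => ?_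
          simp only [Finset.mul_sum]
          rw [Finset.sum_comm]
          exact Finset.sum_congr rfl fun a _ => Finset.sum_congr rfl fun j _ => by ring
  have symm : ∀ a b, tangDer d F G a (ν b) = tangDer d F G b (ν a) := fun a b => by
    simp only [tangDer_apply]
    have e : ∀ a b, ∑ j, (∑ i, G i j * d i (F a)) * d j (ν b) =
        ∑ j, ∑ k, (∑ i, G i j * d i (F a)) * (∑ i, G i k * d i (F b)) *
          ∑ c, d k (F c) * d j (ν c) := fun a b => by
      refine Finset.sum_congr rfl fun j _ => ?_
      conv_lhs => rw [hν j b]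
      rw [Finset.mul_sum]
      exact Finset.sum_congr rfl fun k _ => by ring
    rw [e, e, Finset.sum_comm]
    exact Finset.sum_congr rfl fun k _ => Finset.sum_congr rfl fun j _ => by rw [hs k j]; ring
  have tangent : ∀ φ, ∑ a, ν a * tangDer d F G a φ = 0 := fun φ => by
    simp only [tangDer_apply, Finset.mul_sum, Finset.sum_mul]
    rw [Finset.sum_comm]
    refine Finset.sum_eq_zero fun j _ => ?_
    rw [Finset.sum_comm]
    refine Finset.sum_eq_zero fun i _ => ?_
    have := congrArg (G i j * d j φ * ·) (H.orth i)
    simp only [Finset.mul_sum, mul_zero] at this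
    rw [← this]
    exact Finset.sum_congr rfl fun a _ => by ring
  refine ⟨tangent, symm, ?_, ?_⟩
  · simp only [tangDer_apply]
    rw [Finset.sum_comm, ← H.mean]
    refine Finset.sum_congr rfl fun j _ => ?_
    simp only [Finset.mul_sum, Finset.sum_mul]
    rw [Finset.sum_comm]
    exact Finset.sum_congr rfl fun a _ => Finset.sum_congr rfl fun j _ => by ring
  · intro a b φ
    set X : ι → κ → R := fun a j => ∑ i, G i j * d i (F a) with hX
    have hap : ∀ a φ, tangDer d F G a φ = ∑ j, X a j * d j φ := fun a φ => tangDer_apply a φ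
    set Y : κ → R := fun j => tangDer d F G a (X b j) - tangDer d F G b (X a j) -
      ∑ c, (ν a * tangDer d F G b (ν c) - ν b * tangDer d F G a (ν c)) * X c j with hYd
    have hbr : ∀ φ, tangDer d F G a (tangDer d F G b φ) - tangDer d F G b (tangDer d F G a φ) -
        ∑ c, (ν a * tangDer d F G b (ν c) - ν b * tangDer d F G a (ν c)) * tangDer d F G c φ =
        ∑ j, Y j * d j φ := by
      intro φ
      have e : ∀ a b, tangDer d F G a (tangDer d F G b φ) =
          ∑ j, tangDer d F G a (X b j) * d j φ + ∑ i, ∑ j, X a i * X b j * d i (d j φ) := by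
        intro a b
        rw [hap b φ]
        simp only [map_sum, Derivation.leibniz, smul_eq_mul, Finset.sum_add_distrib]
        rw [add_comm]
        congr 1
        · exact Finset.sum_congr rfl fun j _ => mul_comm _ _
        · rw [Finset.sum_comm]
          refine Finset.sum_congr rfl fun j _ => ?_
          rw [hap, Finset.mul_sum]
          exact Finset.sum_congr rfl fun j _ => by ring
      have e2 : ∑ i, ∑ j, X a i * X b j * d i (d j φ) = ∑ i, ∑ j, X b i * X a j * d i (d j φ) := by
        rw [Finset.sum_comm]
        exact Finset.sum_congr rfl fun j _ => Finset.sum_congr rfl fun i _ => by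
          rw [H.d_comm]; ring
      have e3 : ∑ c, (ν a * tangDer d F G b (ν c) - ν b * tangDer d F G a (ν c)) *
          tangDer d F G c φ = ∑ j, (∑ c, (ν a * tangDer d F G b (ν c) -
            ν b * tangDer d F G a (ν c)) * X c j) * d j φ := by
        simp only [hap _ φ, Finset.mul_sum, Finset.sum_mul]
        rw [Finset.sum_comm]
        exact Finset.sum_congr rfl fun j _ => Finset.sum_congr rfl fun i _ => by ring
      rw [e a b, e b a, e2, e3]
      simp only [hYd, sub_mul, Finset.sum_sub_distrib]
      ring
    have hF : ∀ c, ∑ j, Y j * d j (F c) = 0 := by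
      intro c
      rw [← hbr]
      have hconst : ∀ a c : ι, ∀ D : Derivation ℝ R R, D (if a = c then 1 else 0) = 0 := by
        intro a c D
        split_ifs <;> simp
      have e1 : ∑ e, (ν a * tangDer d F G b (ν e) - ν b * tangDer d F G a (ν e)) *
          tangDer d F G e (F c) = ν a * tangDer d F G b (ν c) - ν b * tangDer d F G a (ν c) := by
        have hn : ∀ b, ∑ e, ν e * tangDer d F G b (ν e) = 0 := fun b => by
          simpa only [symm b] using tangent (ν b)
        have h1 : ∀ e, (ν a * tangDer d F G b (ν e) - ν b * tangDer d F G a (ν e)) *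
            tangDer d F G e (F c) = (if e = c then
              (ν a * tangDer d F G b (ν e) - ν b * tangDer d F G a (ν e)) else 0) -
              (ν a * ν c) * (ν e * tangDer d F G b (ν e)) +
              (ν b * ν c) * (ν e * tangDer d F G a (ν e)) := fun e => by
          rw [H.tangDer_pos]
          split_ifs <;> ring
        simp only [h1, Finset.sum_add_distrib, Finset.sum_sub_distrib, ← Finset.mul_sum, hn]
        simp
      rw [e1]
      simp only [H.tangDer_pos, map_sub, hconst, Derivation.leibniz, smul_eq_mul]
      rw [symm b a]
      ring
    have := hbr φ
    simp only [H.eq_zero Y hF, zero_mul, Finset.sum_const_zero] at this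
    linear_combination this

theorem IsMinimalFrame.derLap_pos (H : IsMinimalFrame d F ν G) (b : ι) :
    derLap (tangDer d F G) (F b) = 0 := by
  have hconst : ∀ a c : ι, ∀ D : Derivation ℝ R R, D (if a = c then 1 else 0) = 0 := by
    intro a c D
    split_ifs <;> simp
  have C := H.isMinimalCalculus
  simp only [derLap, H.tangDer_pos, map_sub, hconst, Derivation.leibniz, smul_eq_mul, zero_sub,
    Finset.sum_neg_distrib, Finset.sum_add_distrib, ← Finset.mul_sum, C.trace, C.tangent]
  ring

end Frame

section Estimate

/-- The scalar inequality behind the interior curvature estimate. -/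
theorem curvature_scalar_ineq {ι : Type*} [Fintype ι] {c η θ k m T N : ℝ} {c' η' θ' : ι → ℝ}
    (hη : 0 < η) (hc : 0 < c) (hk : 0 < k) (hψ : 0 < θ ^ 2 - k) (hθ : θ ^ 2 ≤ 1)
    (hm : m * (θ ^ 2 - k) = c * η ^ 2)
    (hgrad : ∀ a, η ^ 2 * c' a + 2 * c * η * η' a - 2 * m * θ * θ' a = 0)
    (hlap : η ^ 2 * (2 * T - 2 * c ^ 2) + 4 * η * ∑ a, c' a * η' a +
      c * (2 * η * (-2 * N) + 2 * ∑ a, η' a ^ 2) -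
      m * (2 * θ * (-(c * θ)) + 2 * ∑ a, θ' a ^ 2) ≤ 0)
    (hT : ∑ a, c' a ^ 2 ≤ 4 * c * T) :
    k * m ≤ 2 * N * η + (2 + 1 / k) * ∑ a, η' a ^ 2 := by
  obtain ⟨ψ, hψd⟩ : ∃ ψ, ψ = θ ^ 2 - k := ⟨_, rfl⟩
  rw [← hψd] at hψ hm
  have hθ0 : 0 < θ ^ 2 := by linarith
  have hθn : θ ≠ 0 := by rintro rfl; simp at hθ0
  set α : ι → ℝ := fun a => θ * θ' a / ψ with hα
  have hθ' : ∀ a, θ' a = ψ * α a / θ := fun a => by simp only [hα]; field_simp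
  have hmm : m = c * η ^ 2 / ψ := by field_simp; linarith
  have hc' : ∀ a, c' a = 2 * c * α a - 2 * c * η' a / η := fun a => by
    have : η * ψ * c' a + 2 * c * η' a * ψ - 2 * c * η * θ * θ' a = 0 :=
      mul_left_cancel₀ hη.ne' (by linear_combination ψ * hgrad a + 2 * θ * θ' a * hm)
    simp only [hα]
    field_simp
    linear_combination this
  set A := ∑ a, α a ^ 2 with hA
  set B := ∑ a, α a * η' a with hB
  set E := ∑ a, η' a ^ 2 with hE
  have s1 : ∑ a, c' a * η' a = 2 * c * B - 2 * c * E / η := by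
    simp only [hB, hE, Finset.mul_sum, Finset.sum_div, ← Finset.sum_sub_distrib, hc']
    exact Finset.sum_congr rfl fun a _ => by ring
  have s2 : ∑ a, c' a ^ 2 = 4 * c ^ 2 * (A - 2 * B / η + E / η ^ 2) := by
    simp only [hA, hB, hE, Finset.mul_sum, Finset.sum_div, ← Finset.sum_sub_distrib,
      ← Finset.sum_add_distrib, hc']
    exact Finset.sum_congr rfl fun a _ => by field_simp; ring
  have s3 : ∑ a, θ' a ^ 2 = ψ ^ 2 * A / θ ^ 2 := by
    simp only [hA, Finset.mul_sum, Finset.sum_div, hθ']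
    exact Finset.sum_congr rfl fun a _ => by field_simp
  have s4 : 0 ≤ k * η ^ 2 * A + 2 * η * B + E / k := by
    have : k * η ^ 2 * A + 2 * η * B + E / k = ∑ a, k * (η * α a + η' a / k) ^ 2 := by
      simp only [hA, hB, hE, Finset.mul_sum, Finset.sum_div, ← Finset.sum_add_distrib]
      exact Finset.sum_congr rfl fun a _ => by field_simp; ring
    rw [this]
    positivity
  have hA0 : 0 ≤ A := Finset.sum_nonneg fun a _ => sq_nonneg _
  rw [s2] at hT
  rw [s1, s3] at hlap
  have hT' : c * (A - 2 * B / η + E / η ^ 2) ≤ T := by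
    have : 4 * c * (c * (A - 2 * B / η + E / η ^ 2)) ≤ 4 * c * T := by
      rw [← sub_nonneg] at hT ⊢
      calc (0:ℝ) ≤ _ := hT
        _ = _ := by ring
    exact le_of_mul_le_mul_left this (by positivity)
  have h1 : c * (η ^ 2 * A - 2 * η * B + E) ≤ η ^ 2 * T := by
    have := mul_le_mul_of_nonneg_left hT' (sq_nonneg η)
    refine le_trans (le_of_eq ?_) this
    field_simp
  have h2 : m * (ψ ^ 2 * A / θ ^ 2) ≤ c * (η ^ 2 * A * (1 - k)) := by
    have e : m * (ψ ^ 2 * A / θ ^ 2) = c * (η ^ 2 * A * (1 - k / θ ^ 2)) := by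
      rw [hmm]
      field_simp
      ring_nf
      simp only [hψd]
      ring
    rw [e]
    have : k ≤ k / θ ^ 2 := by
      rw [le_div_iff₀ hθ0]; nlinarith
    gcongr
  have h3 : 4 * η * (2 * c * B - 2 * c * E / η) = c * (8 * η * B - 8 * E) := by
    field_simp
    ring
  have h4 : m * c * k = m * c * θ ^ 2 - c * (c * η ^ 2) := by
    rw [← hm]; simp only [hψd]; ring
  have h5 : c * (k * η ^ 2 * A + 2 * η * B - 2 * E - 2 * N * η + m * k) ≤ 0 := by
    rw [h3] at hlap
    nlinarith
  have h6 : k * η ^ 2 * A + 2 * η * B - 2 * E - 2 * N * η + m * k ≤ 0 := by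
    by_contra! h
    exact absurd h5 (not_le.2 (mul_pos hc h))
  have h7 : (2 + 1 / k) * E = 2 * E + E / k := by ring
  rw [h7]
  linarith

variable {R ι κ : Type*} [CommRing R] [Algebra ℝ R] [Fintype κ]

theorem derLap_sub [Fintype ι] (δ : ι → Derivation ℝ R R) (φ ψ : R) :
    derLap δ (φ - ψ) = derLap δ φ - derLap δ ψ := by
  simp [derLap, Finset.sum_sub_distrib]

theorem derLap_smul [Fintype ι] (δ : ι → Derivation ℝ R R) (r : ℝ) (φ : R) :
    derLap δ (r • φ) = r • derLap δ φ := by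
  simp [derLap, Finset.smul_sum]

theorem derLap_sum [Fintype ι] (δ : ι → Derivation ℝ R R) {β : Type*} (s : Finset β) (φ : β → R) :
    derLap δ (∑ b ∈ s, φ b) = ∑ b ∈ s, derLap δ (φ b) := by
  simp only [derLap, map_sum]
  exact Finset.sum_comm

theorem derLap_one [Fintype ι] (δ : ι → Derivation ℝ R R) : derLap δ 1 = 0 := by
  simp [derLap]

theorem derLap_mul [Fintype ι] (δ : ι → Derivation ℝ R R) (φ ψ : R) :
    derLap δ (φ * ψ) = φ * derLap δ ψ + ψ * derLap δ φ + 2 * ∑ a, δ a φ * δ a ψ := by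
  simp only [derLap, Derivation.leibniz, smul_eq_mul, map_add, Finset.mul_sum,
    ← Finset.sum_add_distrib]
  exact Finset.sum_congr rfl fun a _ => by ring

variable [Fintype ι] [DecidableEq ι] [DecidableEq κ]
variable {d : κ → Derivation ℝ R R} {F ν : ι → R} {G : κ → κ → R}

theorem IsMinimalFrame.der_normSq (H : IsMinimalFrame d F ν G) (a : ι) :
    tangDer d F G a (∑ b, F b * F b) = 2 * (F a - ν a * ∑ b, ν b * F b) := by
  simp only [map_sum, Derivation.leibniz, smul_eq_mul, H.tangDer_pos, Finset.sum_add_distrib,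
    mul_sub, Finset.sum_sub_distrib, Finset.mul_sum]
  have : ∀ b, F b * (ν a * ν b) = ν a * (ν b * F b) := fun b => by ring
  simp only [this]
  simp only [mul_ite, mul_one, mul_zero, Finset.sum_ite_eq, Finset.mem_univ, if_true,
    ← Finset.mul_sum]
  ring

theorem IsMinimalFrame.sum_proj_sq (H : IsMinimalFrame d F ν G) :
    ∑ a, ∑ b, ((if a = b then 1 else 0) - ν a * ν b) * ((if a = b then 1 else 0) - ν a * ν b) =
      (Fintype.card ι : R) - 1 := by
  have : ∀ a b, ((if a = b then 1 else 0) - ν a * ν b) * ((if a = b then 1 else 0) - ν a * ν b) =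
      (if a = b then (1 - 2 * (ν a * ν b)) else 0) + (ν a * ν a) * (ν b * ν b) := fun a b => by
    split_ifs <;> ring
  simp only [this, Finset.sum_add_distrib, H.unit, Finset.sum_ite_eq,
    Finset.mem_univ, if_true, Finset.sum_sub_distrib, ← Finset.mul_sum]
  simp [H.unit]
  ring

theorem IsMinimalFrame.derLap_normSq (H : IsMinimalFrame d F ν G) :
    derLap (tangDer d F G) (∑ b, F b * F b) = 2 * ((Fintype.card ι : R) - 1) := by
  rw [derLap_sum, ← H.sum_proj_sq, Finset.sum_comm, Finset.mul_sum]
  refine Finset.sum_congr rfl fun b _ => ?_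
  rw [derLap_mul, H.derLap_pos]
  simp only [H.tangDer_pos]
  ring

/-- The interior curvature estimate at a maximum point, in algebraic form: `ev` is evaluation at
the point. -/
theorem IsMinimalFrame.curvature_le (H : IsMinimalFrame d F ν G) (ev : R →ₐ[ℝ] ℝ)
    (y : ι → ℝ) {k ρ m : ℝ} {θ η : R} (hθ : θ = ∑ b, y b • ν b)
    (hη : η = ρ • 1 - ∑ b, F b * F b)
    (hk : 0 < k) (hη0 : 0 < ev η) (hc0 : 0 < ev (derSq (tangDer d F G) ν))
    (hψ : 0 < ev θ ^ 2 - k) (hθ1 : ev θ ^ 2 ≤ 1)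
    (hm : m * (ev θ ^ 2 - k) = ev (derSq (tangDer d F G) ν) * ev η ^ 2)
    (hgrad : ∀ a, ev (tangDer d F G a
      (derSq (tangDer d F G) ν * (η * η) - m • (θ * θ - k • 1))) = 0)
    (hlap : ev (derLap (tangDer d F G)
      (derSq (tangDer d F G) ν * (η * η) - m • (θ * θ - k • 1))) ≤ 0) :
    k * m ≤ 2 * ((Fintype.card ι : ℝ) - 1) * ev η +
      (2 + 1 / k) * (4 * ∑ b, ev (F b) ^ 2) := by
  have C := H.isMinimalCalculus
  set δ := tangDer d F G with hδ
  set c := derSq δ ν with hc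
  set T := ∑ a, ∑ b, ∑ e, ev (derCovShape δ ν a b e) ^ 2 with hT
  have hev2 : ev 2 = 2 := map_ofNat ev 2
  have hevcard : ev (Fintype.card ι : R) = (Fintype.card ι : ℝ) := map_natCast ev _
  have hlapθ : derLap δ θ = -(c * θ) := by
    rw [hθ, derLap_sum, Finset.mul_sum, ← Finset.sum_neg_distrib]
    refine Finset.sum_congr rfl fun b _ => ?_
    rw [derLap_smul, C.derLap_normal, mul_smul_comm, smul_neg]
  have hlapη : ev (derLap δ η) = -2 * ((Fintype.card ι : ℝ) - 1) := by
    rw [hη, derLap_sub, derLap_smul, derLap_one, H.derLap_normSq]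
    simp [hevcard, hev2]
  have hη' : ∑ a, ev (δ a η) ^ 2 ≤ 4 * ∑ b, ev (F b) ^ 2 := by
    have hunit : ∑ a, ev (ν a) * ev (ν a) = 1 := by
      simpa using congrArg ev H.unit
    have e : ∀ a, ev (δ a η) = -(2 * (ev (F a) - ev (ν a) * ∑ b, ev (ν b) * ev (F b))) := by
      intro a
      rw [hη, map_sub, H.der_normSq]
      simp [hev2]
    set p := ∑ b, ev (ν b) * ev (F b) with hp
    have e2 : ∑ a, ev (δ a η) ^ 2 = 4 * ∑ b, ev (F b) ^ 2 - 8 * p * p + 4 * p ^ 2 * 1 := by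
      rw [← hunit]
      conv_rhs => arg 1; arg 2; arg 2; rw [hp]
      simp only [Finset.mul_sum, ← Finset.sum_add_distrib, ← Finset.sum_sub_distrib, e]
      exact Finset.sum_congr rfl fun a _ => by ring
    rw [e2]
    nlinarith [sq_nonneg p]
  have hlapc : ev (derLap δ c) = 2 * T - 2 * ev c ^ 2 := by
    rw [hc, C.derLap_derSq H.unit]
    simp only [map_sub, map_mul, map_sum, hev2, hT, pow_two]
  have hcT : ∑ a, ev (δ a c) ^ 2 ≤ 4 * ev c * T := by
    rw [hT, Finset.mul_sum]
    refine Finset.sum_le_sum fun a _ => ?_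
    rw [hc, C.der_derSq]
    simp only [map_mul, map_sum, hev2, derSq, ← Finset.sum_product', Finset.univ_product_univ]
    have := Finset.sum_mul_sq_le_sq_mul_sq Finset.univ
      (fun p : ι × ι => ev (δ p.1 (ν p.2))) (fun p : ι × ι => ev (derCovShape δ ν a p.1 p.2))
    simp only [pow_two] at this ⊢
    linarith
  have key := curvature_scalar_ineq (ι := ι) (c := ev c) (η := ev η) (θ := ev θ) (k := k) (m := m)
    (T := T) (N := (Fintype.card ι : ℝ) - 1) (c' := fun a => ev (δ a c))
    (η' := fun a => ev (δ a η)) (θ' := fun a => ev (δ a θ)) hη0 hc0 hk hψ hθ1 hm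
    (fun a => by
      have := hgrad a
      simp only [map_sub, Derivation.leibniz, smul_eq_mul, map_add, map_mul, map_smul,
        Derivation.map_smul, Derivation.map_one_eq_zero, smul_zero, map_zero] at this
      linear_combination this)
    (by
      have h := hlap
      rw [derLap_sub, derLap_smul, derLap_sub, derLap_smul, derLap_one, derLap_mul, derLap_mul,
        derLap_mul, hlapθ] at h
      simp only [map_sub, smul_eq_mul, map_add, map_mul, map_smul, map_sum, map_neg,
        smul_zero, map_zero, hev2, hlapη, hlapc, Derivation.leibniz] at h
      have e : ∑ a, ev (δ a c) * (ev η * ev (δ a η) + ev η * ev (δ a η)) =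
          2 * ev η * ∑ a, ev (δ a c) * ev (δ a η) := by
        rw [Finset.mul_sum]; exact Finset.sum_congr rfl fun a _ => by ring
      rw [e] at h
      simp only [pow_two]
      linarith)
    hcT
  refine key.trans ?_
  have : 0 < 2 + 1 / k := by positivity
  gcongr

end Estimate

section SmoothRing

open scoped ContDiff

/-- The ring of smooth functions on `ℝⁿ`. -/
def smoothFn (n : ℕ) : Subalgebra ℝ ((Fin n → ℝ) → ℝ) where
  carrier := {f | ContDiff ℝ ∞ f}
  mul_mem' := fun {a b} (ha : ContDiff ℝ ∞ a) (hb : ContDiff ℝ ∞ b) =>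
    show ContDiff ℝ ∞ (a * b) from ha.mul hb
  add_mem' := fun {a b} (ha : ContDiff ℝ ∞ a) (hb : ContDiff ℝ ∞ b) =>
    show ContDiff ℝ ∞ (a + b) from ha.add hb
  algebraMap_mem' := fun r => show ContDiff ℝ ∞ (fun _ => r) from contDiff_const

theorem smoothFn_contDiff {n : ℕ} (f : smoothFn n) : ContDiff ℝ ∞ f.1 := f.2

theorem smoothFn_differentiable {n : ℕ} (f : smoothFn n) : Differentiable ℝ f.1 :=
  (smoothFn_contDiff f).differentiable (by simp)

/-- Evaluation of smooth functions at a point. -/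
def smoothEv {n : ℕ} (x : Fin n → ℝ) : smoothFn n →ₐ[ℝ] ℝ :=
  (Pi.evalAlgHom ℝ (fun _ => ℝ) x).comp (smoothFn n).val

theorem smoothEv_apply {n : ℕ} (x : Fin n → ℝ) (f : smoothFn n) : smoothEv x f = f.1 x := rfl

theorem contDiff_pdr {n : ℕ} (i : Fin n) {f : (Fin n → ℝ) → ℝ} (hf : ContDiff ℝ ∞ f) :
    ContDiff ℝ ∞ (pdr i f) :=
  (hf.fderiv_right (m := ∞) (by simp)).clm_apply contDiff_const

/-- The partial derivatives as derivations of the ring of smooth functions. -/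
def smoothPd {n : ℕ} (i : Fin n) : Derivation ℝ (smoothFn n) (smoothFn n) :=
  Derivation.mk'
    { toFun := fun f => ⟨pdr i f.1, contDiff_pdr i f.2⟩
      map_add' := fun f g => by
        ext x
        simp only [pdr]
        change fderiv ℝ (f.1 + g.1) x _ = fderiv ℝ f.1 x _ + fderiv ℝ g.1 x _
        rw [fderiv_add (smoothFn_differentiable f x) (smoothFn_differentiable g x)]
        rfl
      map_smul' := fun r f => by
        ext x
        simp only [pdr]
        change fderiv ℝ (r • f.1) x _ = r • fderiv ℝ f.1 x _
        rw [fderiv_const_smul (smoothFn_differentiable f x)]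
        rfl }
    (fun f g => by
      ext x
      change fderiv ℝ (f.1 * g.1) x _ = f.1 x * fderiv ℝ g.1 x _ + g.1 x * fderiv ℝ f.1 x _
      rw [fderiv_mul (smoothFn_differentiable f x) (smoothFn_differentiable g x)]
      rfl)

theorem smoothPd_coe {n : ℕ} (i : Fin n) (f : smoothFn n) : (smoothPd i f).1 = pdr i f.1 := rfl

theorem smoothPd_comm {n : ℕ} (i j : Fin n) (f : smoothFn n) :
    smoothPd i (smoothPd j f) = smoothPd j (smoothPd i f) := by
  ext x
  have key : ∀ i j : Fin n, pdr i (pdr j f.1) x =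
      fderiv ℝ (fderiv ℝ f.1) x (Pi.single i 1) (Pi.single j 1) := fun i j => by
    have hd : DifferentiableAt ℝ (fderiv ℝ f.1) x :=
      ((smoothFn_contDiff f).fderiv_right (m := ∞) (by simp)).differentiable (by simp) x
    change fderiv ℝ (fun y => fderiv ℝ f.1 y (Pi.single j 1)) x (Pi.single i 1) = _
    rw [fderiv_clm_apply hd (differentiableAt_const _)]
    simp
  have hs : IsSymmSndFDerivAt ℝ f.1 x :=
    (smoothFn_contDiff f).contDiffAt.isSymmSndFDerivAt (by simpa using ENat.LEInfty.out)
  change pdr i (pdr j f.1) x = pdr j (pdr i f.1) x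
  rw [key, key, hs.eq]

theorem contDiff_det {E κ : Type*} [NormedAddCommGroup E] [NormedSpace ℝ E] [Fintype κ]
    [DecidableEq κ] {m : WithTop ℕ∞} {M : E → Matrix κ κ ℝ}
    (hM : ∀ i j, ContDiff ℝ m fun x => M x i j) : ContDiff ℝ m fun x => (M x).det := by
  simp only [Matrix.det_apply']
  exact ContDiff.sum fun σ _ => contDiff_const.mul (contDiff_prod fun i _ => hM _ _)

theorem contDiff_matrix_inv {E κ : Type*} [NormedAddCommGroup E] [NormedSpace ℝ E] [Fintype κ]
    [DecidableEq κ] {m : WithTop ℕ∞} {M : E → Matrix κ κ ℝ}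
    (hM : ∀ i j, ContDiff ℝ m fun x => M x i j) (hdet : ∀ x, (M x).det ≠ 0) (i j : κ) :
    ContDiff ℝ m fun x => (M x)⁻¹ i j := by
  simp only [Matrix.inv_def, Ring.inverse_eq_inv', Matrix.smul_apply, Matrix.adjugate_apply,
    smul_eq_mul]
  refine ((contDiff_det hM).inv hdet).mul (contDiff_det fun k l => ?_)
  simp only [Matrix.updateRow_apply]
  split_ifs
  · exact contDiff_const
  · exact hM k l

theorem Matrix.mul_inv_gram_mul_transpose {κ ι : Type*} [Fintype κ] [DecidableEq κ] [Fintype ι]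
    [DecidableEq ι] (hcard : Fintype.card ι = Fintype.card κ + 1) (J : Matrix ι κ ℝ) (v : ι → ℝ)
    (hdet : (J.transpose * J).det ≠ 0) (hv : ∑ a, v a * v a = 1)
    (hvJ : ∀ i, ∑ a, v a * J a i = 0) (a b : ι) :
    (J * (J.transpose * J)⁻¹ * J.transpose) a b = (if a = b then 1 else 0) - v a * v b := by
  set g := J.transpose * J with hg
  have hinv : g⁻¹ * g = 1 := Matrix.nonsing_inv_mul _ (isUnit_iff_ne_zero.2 hdet)
  have h1 : Matrix.fromRows (g⁻¹ * J.transpose) (Matrix.replicateRow Unit v) *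
      Matrix.fromCols J (Matrix.replicateCol Unit v) = 1 := by
    rw [Matrix.fromRows_mul_fromCols, ← Matrix.fromBlocks_one]
    congr 1
    · rw [Matrix.mul_assoc, ← hg, hinv]
    · rw [Matrix.mul_assoc]
      have : J.transpose * Matrix.replicateCol Unit v = 0 := by
        ext i j
        simp only [Matrix.mul_apply, Matrix.transpose_apply, Matrix.replicateCol_apply,
          Matrix.zero_apply, ← hvJ i]
        exact Finset.sum_congr rfl fun a _ => mul_comm _ _
      rw [this, Matrix.mul_zero]
    · ext i j
      simpa [Matrix.mul_apply] using hvJ j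
    · ext i j
      simpa [Matrix.mul_apply] using hv
  rw [Matrix.mul_eq_one_comm_of_card_eq _ _ _ (by simp [hcard]), Matrix.fromCols_mul_fromRows] at h1
  have := congrFun (congrFun h1 a) b
  simp only [Matrix.add_apply, Matrix.one_apply, ← Matrix.mul_assoc] at this
  rw [← this]
  simp [Matrix.mul_apply]

end SmoothRing

section Geometry

open scoped ContDiff

variable {n : ℕ} {F ν : (Fin n → ℝ) → EuclideanSpace ℝ (Fin (n + 1))}

/-- A coordinate of a smooth vector-valued map. -/
def smoothCoord (F : (Fin n → ℝ) → EuclideanSpace ℝ (Fin (n + 1))) (hF : ContDiff ℝ ∞ F)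
    (a : Fin (n + 1)) : smoothFn n :=
  ⟨fun x => F x a, contDiff_euclidean.1 hF a⟩

theorem pdr_coord (hF : ContDiff ℝ ∞ F) (i : Fin n) (a : Fin (n + 1)) (x : Fin n → ℝ) :
    pdr i (fun y => F y a) x = pdv i F x a := by
  have h := (EuclideanSpace.proj a : EuclideanSpace ℝ (Fin (n + 1)) →L[ℝ] ℝ).hasFDerivAt.comp x
    ((hF.differentiable (by simp)) x).hasFDerivAt
  have h2 : fderiv ℝ (fun y => F y a) x = _ := h.fderiv
  rw [pdr, h2]
  rfl

theorem contDiff_pdv (hF : ContDiff ℝ ∞ F) (i : Fin n) : ContDiff ℝ ∞ (pdv i F) :=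
  (hF.fderiv_right (m := ∞) (by simp)).clm_apply contDiff_const

theorem euclidean_inner_eq_sum {m : ℕ} (x y : EuclideanSpace ℝ (Fin m)) :
    ⟪x, y⟫ = ∑ a, x a * y a := by
  rw [PiLp.inner_apply]
  exact Finset.sum_congr rfl fun a _ => by simp [mul_comm]

/-- An entry of the inverse metric. -/
def smoothInvMet (hF : ContDiff ℝ ∞ F) (himm : ∀ x, (gmet F x).det ≠ 0) (i j : Fin n) :
    smoothFn n :=
  ⟨fun x => (gmet F x)⁻¹ i j, contDiff_matrix_inv
    (fun i j => (contDiff_pdv hF i).inner ℝ (contDiff_pdv hF j)) himm i j⟩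

theorem gmet_transpose (x : Fin n → ℝ) : (gmet F x).transpose = gmet F x := by
  ext i j
  simp only [gmet, Matrix.transpose_apply, Matrix.of_apply, real_inner_comm]

theorem isMinimalFrame (hF : ContDiff ℝ ∞ F) (hν : ContDiff ℝ ∞ ν)
    (hunit : ∀ x, ‖ν x‖ = 1) (horth : ∀ x i, ⟪ν x, pdv i F x⟫ = 0)
    (himm : ∀ x, (gmet F x).det ≠ 0) (hmin : ∀ x, meanCurv F ν x = 0) :
    IsMinimalFrame smoothPd (smoothCoord F hF) (smoothCoord ν hν) (smoothInvMet hF himm) := by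
  have hval : ∀ f g : smoothFn n, (∀ x, smoothEv x f = smoothEv x g) → f = g := fun f g h =>
    Subtype.ext (funext h)
  have hc : ∀ {F : (Fin n → ℝ) → EuclideanSpace ℝ (Fin (n + 1))} (hF : ContDiff ℝ ∞ F) x a,
      smoothEv x (smoothCoord F hF a) = F x a :=
    fun _ _ _ => rfl
  have hG : ∀ x i j, smoothEv x (smoothInvMet hF himm i j) = (gmet F x)⁻¹ i j := fun _ _ _ => rfl
  have hd : ∀ {F : (Fin n → ℝ) → EuclideanSpace ℝ (Fin (n + 1))} (hF : ContDiff ℝ ∞ F) x i a,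
      smoothEv x (smoothPd i (smoothCoord F hF a)) = pdv i F x a :=
    fun hF x i a => pdr_coord hF i a x
  have hg : ∀ x i l, ∑ a, pdv i F x a * pdv l F x a = gmet F x i l := fun x i l => by
    rw [← euclidean_inner_eq_sum]; rfl
  have hgs : ∀ x i l, gmet F x i l = gmet F x l i := fun x i l => by
    conv_lhs => rw [← gmet_transpose]
    rfl
  have hν1 : ∀ x, ∑ a, ν x a * ν x a = 1 := fun x => by
    rw [← euclidean_inner_eq_sum, real_inner_self_eq_norm_sq, hunit]; norm_num
  have hνF : ∀ x i, ∑ a, ν x a * pdv i F x a = 0 := fun x i => by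
    rw [← euclidean_inner_eq_sum, horth]
  have horthR : ∀ i, ∑ a, smoothCoord ν hν a * smoothPd i (smoothCoord F hF a) = 0 := fun i =>
    hval _ _ fun x => by
      simp only [map_sum, map_mul, map_zero, hc, hd]
      exact hνF x i
  refine ⟨smoothPd_comm, fun k l => hval _ _ fun x => ?_, hval _ _ fun x => ?_, horthR,
    fun a b => hval _ _ fun x => ?_, hval _ _ fun x => ?_⟩
  · simp only [map_sum, map_mul, hG, hd, hg]
    have := congrFun (congrFun
      (Matrix.mul_nonsing_inv (gmet F x) (isUnit_iff_ne_zero.2 (himm x))) l) k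
    rw [Matrix.mul_apply, Matrix.one_apply] at this
    rw [apply_ite (smoothEv x), map_one, map_zero]
    simp only [eq_comm (a := k)]
    rw [← this]
    exact Finset.sum_congr rfl fun i _ => by rw [mul_comm, hgs]
  · simp only [map_sum, map_mul, map_one, hc]
    exact hν1 x
  · simp only [map_sum, map_mul, hG, hd, hc, map_sub]
    rw [apply_ite (smoothEv x), map_one, map_zero]
    set J : Matrix (Fin (n + 1)) (Fin n) ℝ := Matrix.of fun a i => pdv i F x a with hJ
    have hJg : J.transpose * J = gmet F x := by
      ext i j
      rw [← hg, Matrix.mul_apply]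
      rfl
    have := Matrix.mul_inv_gram_mul_transpose (by simp) J (fun a => ν x a) (by rw [hJg]; exact himm x)
      (hν1 x) (fun i => hνF x i) a b
    rw [← this, hJg, Matrix.mul_apply]
    refine Finset.sum_congr rfl fun j _ => ?_
    rw [Matrix.mul_apply]
    congr 1
    exact Finset.sum_congr rfl fun i _ => mul_comm _ _
  · simp only [map_sum, map_mul, map_zero, hG, hd]
    have hm := hmin x
    rw [meanCurv, Finset.sum_comm] at hm
    rw [← hm]
    refine Finset.sum_congr rfl fun j _ => Finset.sum_congr rfl fun i _ => ?_
    congr 1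
    have h := congrArg (fun f => smoothEv x (smoothPd j f)) (horthR i)
    simp only [map_sum, Derivation.leibniz, smul_eq_mul, map_add, map_mul, map_zero,
      Finset.sum_add_distrib, hc, hd] at h
    have hdd : ∀ a, smoothEv x (smoothPd i (smoothPd j (smoothCoord F hF a))) =
        pdv i (fun y => pdv j F y) x a := fun a => by
      rw [← pdr_coord (contDiff_pdv hF j)]
      have : (fun y => pdv j F y a) = pdr j (fun y => F y a) :=
        funext fun y => (pdr_coord hF j a y).symm
      rw [this]
      rfl
    rw [sff, euclidean_inner_eq_sum]
    simp only [← hdd, smoothPd_comm i j]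
    rw [← sub_eq_zero, sub_neg_eq_add, ← h, add_comm]
    congr 1
    exact Finset.sum_congr rfl fun a _ => mul_comm _ _

end Geometry

section MaximumPrinciple

open scoped ContDiff

theorem IsLocalMax.deriv_deriv_nonpos {φ : ℝ → ℝ} {t : ℝ} (h : IsLocalMax φ t)
    (hc : ContinuousAt φ t) : deriv (deriv φ) t ≤ 0 := by
  by_contra! hpos
  have hmin := isLocalMin_of_deriv_deriv_pos hpos h.deriv_eq_zero hc
  have heq : φ =ᶠ[nhds t] fun _ => φ t := by
    filter_upwards [h, hmin] with s h1 h2 using le_antisymm h1 h2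
  have h2 : deriv φ =ᶠ[nhds t] fun _ => 0 := by
    simpa using heq.deriv
  rw [h2.deriv_eq] at hpos
  simp at hpos

theorem smoothFn_hasDerivAt_line {n : ℕ} (f : smoothFn n) (x v : Fin n → ℝ) (t : ℝ) :
    HasDerivAt (fun s : ℝ => f.1 (x + s • v)) (∑ j, v j * (smoothPd j f).1 (x + t • v)) t := by
  have hl : HasDerivAt (fun s : ℝ => x + s • v) v t := by
    simpa using ((hasDerivAt_id t).smul_const v).const_add x
  have h := (smoothFn_differentiable f (x + t • v)).hasFDerivAt.comp_hasDerivAt t hl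
  have hsum : ∀ L : (Fin n → ℝ) →L[ℝ] ℝ, L v = ∑ j, v j * L (Pi.single j 1) := fun L => by
    rw [← Finset.univ_sum_single v, map_sum]
    refine Finset.sum_congr rfl fun j _ => ?_
    rw [← smul_eq_mul, ← map_smul, ← Pi.single_smul, smul_eq_mul, mul_one]
    simp
  rw [hsum] at h
  exact h

theorem smoothEv_smoothPd_of_isLocalMax {n : ℕ} {W : smoothFn n} {x : Fin n → ℝ}
    (h : IsLocalMax W.1 x) (j : Fin n) : smoothEv x (smoothPd j W) = 0 := by
  rw [smoothEv_apply, smoothPd_coe, pdr, h.fderiv_eq_zero]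
  rfl

theorem smoothEv_der_der_nonpos {n : ℕ} {W : smoothFn n} {x : Fin n → ℝ}
    (h : IsLocalMax W.1 x) (c : Fin n → smoothFn n) :
    smoothEv x (∑ i, c i * smoothPd i (∑ j, c j * smoothPd j W)) ≤ 0 := by
  set v : Fin n → ℝ := fun j => (c j).1 x with hv
  have hd : deriv (fun s : ℝ => W.1 (x + s • v)) =
      fun s => ∑ j, v j * (smoothPd j W).1 (x + s • v) :=
    funext fun t => (smoothFn_hasDerivAt_line W x v t).deriv
  have hdd : deriv (deriv fun s : ℝ => W.1 (x + s • v)) 0 =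
      ∑ j, v j * ∑ i, v i * (smoothPd i (smoothPd j W)).1 x := by
    rw [hd]
    have := HasDerivAt.fun_sum (u := Finset.univ) fun j _ =>
      (smoothFn_hasDerivAt_line (smoothPd j W) x v 0).const_mul (v j)
    simpa using this.deriv
  have hcont : Continuous fun s : ℝ => x + s • v := by fun_prop
  have hmax : IsLocalMax (fun s : ℝ => W.1 (x + s • v)) 0 := by
    have h0 : Filter.Tendsto (fun s : ℝ => x + s • v) (nhds 0) (nhds x) := by
      simpa using hcont.tendsto 0
    have := h0.eventually h
    simpa [IsLocalMax, IsMaxFilter] using this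
  have hle := hmax.deriv_deriv_nonpos
    ((smoothFn_contDiff W).continuous.comp hcont).continuousAt
  refine le_of_eq_of_le ?_ hle
  rw [hdd]
  simp only [map_sum, Derivation.leibniz, smul_eq_mul, map_add, map_mul,
    smoothEv_smoothPd_of_isLocalMax h, zero_mul, add_zero, Finset.mul_sum]
  rw [Finset.sum_comm]
  refine Finset.sum_congr rfl fun j _ => Finset.sum_congr rfl fun i _ => ?_
  simp only [smoothEv_apply, hv]
  ring

end MaximumPrinciple

section CurvatureBound

theorem IsMinimalFrame.sum_mul_tangDer {κ ι R : Type*} [Fintype κ] [Fintype ι] [DecidableEq κ]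
    [DecidableEq ι] [CommRing R] [Algebra ℝ R] {d : κ → Derivation ℝ R R} {F ν : ι → R}
    {G : κ → κ → R} (H : IsMinimalFrame d F ν G) (k : κ) (φ : R) :
    ∑ a, d k (F a) * tangDer d F G a φ = d k φ := by
  have h : ∀ j, (∑ i, G i j * ∑ a, d i (F a) * d k (F a)) * d j φ = if j = k then d j φ else 0 :=
    fun j => by rw [H.inv, ite_mul, one_mul, zero_mul]
  simp only [tangDer_apply]
  calc _ = ∑ j, (∑ i, G i j * ∑ a, d i (F a) * d k (F a)) * d j φ := by
        simp only [Finset.mul_sum, Finset.sum_mul]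
        rw [Finset.sum_comm]
        refine Finset.sum_congr rfl fun j _ => ?_
        rw [Finset.sum_comm]
        exact Finset.sum_congr rfl fun i _ => Finset.sum_congr rfl fun a _ => by ring
    _ = d k φ := by
        simp [h]

theorem smoothFn_eq_of_smoothPd_eq_zero {n : ℕ} {f : smoothFn n} (h : ∀ j, smoothPd j f = 0)
    (x y : Fin n → ℝ) : f.1 x = f.1 y := by
  have hd : ∀ t : ℝ, HasDerivAt (fun s : ℝ => f.1 (x + s • (y - x))) 0 t := fun t => by
    simpa [h] using smoothFn_hasDerivAt_line f x (y - x) t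
  have := is_const_of_deriv_eq_zero (fun t => (hd t).differentiableAt) (fun t => (hd t).deriv) 0 1
  simpa using this

variable {n : ℕ} {P N : Fin (n + 1) → smoothFn n} {G : Fin n → Fin n → smoothFn n}

/-- `|A|²` as a smooth function. -/
def shapeSq (P N : Fin (n + 1) → smoothFn n) (G : Fin n → Fin n → smoothFn n) : smoothFn n :=
  derSq (tangDer smoothPd P G) N

theorem shapeSq_nonneg (x : Fin n → ℝ) : 0 ≤ (shapeSq P N G).1 x := by
  rw [← smoothEv_apply, shapeSq]
  simp only [derSq, map_sum, map_mul]
  exact Finset.sum_nonneg fun a _ => Finset.sum_nonneg fun b _ => mul_self_nonneg _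

theorem IsMinimalFrame.shapeSq_mul_sq_le (H : IsMinimalFrame smoothPd P N G)
    (y : Fin (n + 1) → ℝ) {θ₀ : ℝ} (hθ₀ : 0 < θ₀)
    (hθ : ∀ x, θ₀ ≤ ∑ b, y b * (N b).1 x) (hθ1 : ∀ x, ∑ b, y b * (N b).1 x ≤ 1) {ρ : ℝ}
    (hK : IsCompact {x | ∑ b, (P b).1 x ^ 2 ≤ ρ}) {x : Fin n → ℝ}
    (hx : ∑ b, (P b).1 x ^ 2 < ρ) :
    (shapeSq P N G).1 x * (ρ - ∑ b, (P b).1 x ^ 2) ^ 2 ≤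
      (2 * (n : ℝ) + (2 + 1 / (θ₀ ^ 2 / 2)) * 4) * ρ / (θ₀ ^ 2 / 2) := by
  set k := θ₀ ^ 2 / 2 with hk
  have hk0 : 0 < k := by positivity
  have hc0 : ∀ z, 0 ≤ (shapeSq P N G).1 z := shapeSq_nonneg
  generalize hc : shapeSq P N G = c at hc0 ⊢
  obtain ⟨θ, hθd⟩ : ∃ θ : smoothFn n, θ = ∑ b, y b • N b := ⟨_, rfl⟩
  obtain ⟨η, hηd⟩ : ∃ η : smoothFn n, η = ρ • 1 - ∑ b, P b * P b := ⟨_, rfl⟩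
  have hρ : 0 < ρ := lt_of_le_of_lt (Finset.sum_nonneg fun b _ => sq_nonneg _) hx
  have evθ : ∀ z, θ.1 z = ∑ b, y b * (N b).1 z := fun z => by
    rw [← smoothEv_apply, hθd]
    simp only [map_sum, map_smul, smul_eq_mul, smoothEv_apply]
  have evη : ∀ z, η.1 z = ρ - ∑ b, (P b).1 z ^ 2 := fun z => by
    rw [← smoothEv_apply, hηd]
    simp only [map_sub, map_sum, map_smul, smul_eq_mul, map_mul, map_one, mul_one, smoothEv_apply,
      pow_two]
  have hψ : ∀ z, 0 < θ.1 z ^ 2 - k := fun z => by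
    have := hθ z
    rw [← evθ] at this
    nlinarith
  have hψ1 : ∀ z, θ.1 z ^ 2 ≤ 1 := fun z => by
    have h1 := hθ z
    have h2 := hθ1 z
    rw [← evθ] at h1 h2
    nlinarith
  have hcont : ∀ f : smoothFn n, Continuous f.1 := fun f => (smoothFn_contDiff f).continuous
  obtain ⟨z, hzK, hz⟩ := hK.exists_isMaxOn ⟨x, hx.le⟩
    (f := fun z => c.1 z * η.1 z ^ 2 / (θ.1 z ^ 2 - k))
    (Continuous.continuousOn (((hcont c).mul ((hcont η).pow 2)).div
      (((hcont θ).pow 2).sub continuous_const) fun z => (hψ z).ne'))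
  set m := c.1 z * η.1 z ^ 2 / (θ.1 z ^ 2 - k) with hmd
  have hmax : ∀ w, ∑ b, (P b).1 w ^ 2 ≤ ρ → c.1 w * η.1 w ^ 2 ≤ m * (θ.1 w ^ 2 - k) := fun w hw =>
    (div_le_iff₀ (hψ w)).1 (hz hw)
  have hm0 : 0 ≤ m := div_nonneg (mul_nonneg (hc0 z) (sq_nonneg _)) (hψ z).le
  have key : k * m ≤ (2 * (n : ℝ) + (2 + 1 / k) * 4) * ρ := by
    rcases hm0.eq_or_lt with h0 | hpos
    · rw [← h0, mul_zero]
      positivity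
    have hprod : c.1 z * η.1 z ^ 2 ≠ 0 := fun h => by
      rw [hmd, h, zero_div] at hpos
      exact lt_irrefl _ hpos
    have hcz : 0 < c.1 z := (hc0 z).lt_of_ne' (left_ne_zero_of_mul hprod)
    have hηz : 0 < η.1 z := by
      refine lt_of_le_of_ne ?_ (fun h => hprod (by rw [← h]; ring))
      rw [evη, sub_nonneg]
      exact hzK
    have hmeq : m * (θ.1 z ^ 2 - k) = c.1 z * η.1 z ^ 2 := div_mul_cancel₀ _ (hψ z).ne'
    obtain ⟨W, hW⟩ : ∃ W : smoothFn n, W = c * (η * η) - m • (θ * θ - k • 1) := ⟨_, rfl⟩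
    have evW : ∀ w, W.1 w = c.1 w * η.1 w ^ 2 - m * (θ.1 w ^ 2 - k) := fun w => by
      rw [← smoothEv_apply, hW]
      simp only [map_sub, map_smul, smul_eq_mul, map_mul, map_one, mul_one, smoothEv_apply,
        pow_two]
    have hloc : IsLocalMax W.1 z := by
      filter_upwards [((hcont η).tendsto z).eventually (lt_mem_nhds hηz)] with w hw
      rw [evW, evW, hmeq, sub_self, sub_nonpos]
      rw [evη, sub_pos] at hw
      exact hmax w hw.le
    have hgrad : ∀ a, smoothEv z (tangDer smoothPd P G a W) = 0 := fun a => by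
      rw [tangDer_apply, map_sum]
      exact Finset.sum_eq_zero fun j _ => by
        rw [map_mul, smoothEv_smoothPd_of_isLocalMax hloc, mul_zero]
    have hlap : smoothEv z (derLap (tangDer smoothPd P G) W) ≤ 0 := by
      rw [derLap, map_sum]
      refine Finset.sum_nonpos fun a _ => ?_
      simp only [tangDer_apply]
      exact smoothEv_der_der_nonpos hloc _
    subst hW
    rw [← hc, shapeSq] at hgrad hlap hcz hmeq
    have := H.curvature_le (smoothEv z) y hθd hηd hk0 hηz hcz (hψ z) (hψ1 z) hmeq hgrad hlap
    refine this.trans ?_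
    simp only [smoothEv_apply, evη, Fintype.card_fin]
    have hS : 0 ≤ ∑ b, (P b).1 z ^ 2 := Finset.sum_nonneg fun b _ => sq_nonneg _
    have hSρ : ∑ b, (P b).1 z ^ 2 ≤ ρ := hzK
    have h1 : (2 + 1 / k) * (4 * ∑ b, (P b).1 z ^ 2) ≤ (2 + 1 / k) * (4 * ρ) := by gcongr
    have h2 : 2 * (((n + 1 : ℕ) : ℝ) - 1) * (ρ - ∑ b, (P b).1 z ^ 2) ≤ 2 * (n : ℝ) * ρ := by
      push_cast
      rw [add_sub_cancel_right]
      gcongr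
      linarith
    linarith
  have h1 := hmax x hx.le
  rw [evη] at h1
  have h2 : m * (θ.1 x ^ 2 - k) ≤ m * 1 := by
    gcongr
    linarith [hψ1 x]
  rw [le_div_iff₀ hk0]
  nlinarith

theorem IsMinimalFrame.shapeSq_eq_zero (H : IsMinimalFrame smoothPd P N G)
    (y : Fin (n + 1) → ℝ) {θ₀ : ℝ} (hθ₀ : 0 < θ₀)
    (hθ : ∀ x, θ₀ ≤ ∑ b, y b * (N b).1 x) (hθ1 : ∀ x, ∑ b, y b * (N b).1 x ≤ 1)
    (hK : ∀ ρ, IsCompact {x | ∑ b, (P b).1 x ^ 2 ≤ ρ}) (x : Fin n → ℝ) :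
    (shapeSq P N G).1 x = 0 := by
  refine le_antisymm ?_ (shapeSq_nonneg x)
  by_contra! hc
  set c := (shapeSq P N G).1 x
  set A := ∑ b, (P b).1 x ^ 2 with hA
  have hA0 : 0 ≤ A := Finset.sum_nonneg fun b _ => sq_nonneg _
  set B := (2 * (n : ℝ) + (2 + 1 / (θ₀ ^ 2 / 2)) * 4) / (θ₀ ^ 2 / 2) with hB
  have hB0 : 0 ≤ B := by positivity
  have hs : 0 < A + 2 * B / c + 1 := by positivity
  have h := H.shapeSq_mul_sq_le y hθ₀ hθ hθ1 (hK (A + (A + 2 * B / c + 1))) (x := x)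
    (by rw [← hA]; linarith)
  rw [← hA, add_sub_cancel_left, mul_div_right_comm _ _ (θ₀ ^ 2 / 2), ← hB] at h
  change c * _ ≤ _ at h
  set s := A + 2 * B / c + 1 with hsd
  have h1 : c * s = c * (A + 1) + 2 * B := by
    rw [hsd]
    field_simp
    ring
  have h2 : A + s ≤ 2 * s := by
    have : 0 ≤ 2 * B / c := by positivity
    linarith
  have h3 : B * (A + s) ≤ B * (2 * s) := by gcongr
  have h4 : c * s ^ 2 = (c * (A + 1) + 2 * B) * s := by rw [← h1]; ring
  have h5 : 0 < c * (A + 1) * s := by positivity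
  linarith

theorem IsMinimalFrame.normal_eq (H : IsMinimalFrame smoothPd P N G)
    (y : Fin (n + 1) → ℝ) {θ₀ : ℝ} (hθ₀ : 0 < θ₀)
    (hθ : ∀ x, θ₀ ≤ ∑ b, y b * (N b).1 x) (hθ1 : ∀ x, ∑ b, y b * (N b).1 x ≤ 1)
    (hK : ∀ ρ, IsCompact {x | ∑ b, (P b).1 x ^ 2 ≤ ρ}) (b : Fin (n + 1)) (x z : Fin n → ℝ) :
    (N b).1 x = (N b).1 z := by
  have h0 : ∀ a b, tangDer smoothPd P G a (N b) = 0 := fun a b => by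
    refine Subtype.ext (funext fun x => ?_)
    have h := H.shapeSq_eq_zero y hθ₀ hθ hθ1 hK x
    rw [← smoothEv_apply, shapeSq] at h
    simp only [derSq, map_sum, map_mul] at h
    rw [Finset.sum_eq_zero_iff_of_nonneg fun a _ =>
      Finset.sum_nonneg fun b _ => mul_self_nonneg _] at h
    have h1 := h a (Finset.mem_univ _)
    rw [Finset.sum_eq_zero_iff_of_nonneg fun b _ => mul_self_nonneg _] at h1
    exact mul_self_eq_zero.1 (h1 b (Finset.mem_univ _))
  refine smoothFn_eq_of_smoothPd_eq_zero (fun j => ?_) x z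
  rw [← H.sum_mul_tangDer]
  exact Finset.sum_eq_zero fun a _ => by rw [h0, mul_zero]

end CurvatureBound

section IntrinsicDistance

open scoped ContDiff Topology

open Filter Set

variable {n : ℕ} {F : (Fin n → ℝ) → EuclideanSpace ℝ (Fin (n + 1))}

theorem exists_norm_fderiv_le_of_hasCompactSupport (hF : ContDiff ℝ ∞ F)
    (himm : ∀ x v, fderiv ℝ F x v = 0 → v = 0) {χ : (Fin n → ℝ) → ℝ} (hχ : ContDiff ℝ ∞ χ)
    (hs : HasCompactSupport χ) :
    ∃ C : ℝ, 0 ≤ C ∧ ∀ x v, ‖fderiv ℝ χ x v‖ ≤ C * ‖fderiv ℝ F x v‖ := by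
  have hcF : Continuous fun p : (Fin n → ℝ) × (Fin n → ℝ) => fderiv ℝ F p.1 p.2 :=
    ((hF.continuous_fderiv (by simp)).comp continuous_fst).clm_apply continuous_snd
  have hcχ : Continuous fun p : (Fin n → ℝ) × (Fin n → ℝ) => fderiv ℝ χ p.1 p.2 :=
    ((hχ.continuous_fderiv (by simp)).comp continuous_fst).clm_apply continuous_snd
  have hne : ∀ p ∈ tsupport χ ×ˢ Metric.sphere (0 : Fin n → ℝ) 1, ‖fderiv ℝ F p.1 p.2‖ ≠ 0 :=
    fun p hp h => by
      have h0 := himm _ _ (norm_eq_zero.1 h)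
      have h1 : ‖p.2‖ = 1 := by simpa using hp.2
      rw [h0, norm_zero] at h1
      exact zero_ne_one h1
  obtain ⟨C, hC⟩ := (IsCompact.prod hs (isCompact_sphere (0 : Fin n → ℝ) 1)).exists_bound_of_continuousOn
    (f := fun p : (Fin n → ℝ) × (Fin n → ℝ) => ‖fderiv ℝ χ p.1 p.2‖ / ‖fderiv ℝ F p.1 p.2‖)
    (hcχ.norm.continuousOn.div hcF.norm.continuousOn hne)
  refine ⟨max C 0, le_max_right _ _, fun x v => ?_⟩
  by_cases hx : x ∈ tsupport χ
  · rcases eq_or_ne v 0 with rfl | hv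
    · simp
    have hv' : 0 < ‖v‖ := norm_pos_iff.2 hv
    have hmem : ((x, ‖v‖⁻¹ • v) : (Fin n → ℝ) × (Fin n → ℝ)) ∈
        tsupport χ ×ˢ Metric.sphere (0 : Fin n → ℝ) 1 :=
      ⟨hx, by simp [norm_smul, hv'.ne']⟩
    have h1 := hC _ hmem
    have h2 := hne _ hmem
    simp only [map_smul, norm_smul, norm_inv, norm_norm, norm_div, norm_mul] at h1 h2
    rw [mul_div_mul_left _ _ (inv_ne_zero hv'.ne')] at h1
    have h3 : 0 < ‖fderiv ℝ F x v‖ :=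
      lt_of_le_of_ne (norm_nonneg _) (right_ne_zero_of_mul h2).symm
    rw [div_le_iff₀ h3] at h1
    exact h1.trans (by gcongr; exact le_max_left _ _)
  · rw [fderiv_of_notMem_tsupport ℝ hx]
    simp only [zero_apply, norm_zero]
    positivity

theorem indDist_le_of_norm_fderiv_le {γ : ℝ → Fin n → ℝ} (hγ : ContDiff ℝ 1 γ) {K : ℝ}
    (hK : ∀ t ∈ Icc (0 : ℝ) 1, ‖fderiv ℝ (F ∘ γ) t 1‖ ≤ K) : indDist F (γ 0) (γ 1) ≤ K := by
  have hbdd : BddBelow {L | ∃ γ' : ℝ → Fin n → ℝ, ContDiff ℝ 1 γ' ∧ γ' 0 = γ 0 ∧ γ' 1 = γ 1 ∧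
      L = ∫ t in (0:ℝ)..1, ‖fderiv ℝ (F ∘ γ') t 1‖} := by
    refine ⟨0, ?_⟩
    rintro L ⟨γ, -, -, -, rfl⟩
    exact intervalIntegral.integral_nonneg zero_le_one fun t _ => norm_nonneg _
  refine (csInf_le hbdd ⟨γ, hγ, rfl, rfl, rfl⟩).trans ?_
  have := intervalIntegral.norm_integral_le_of_norm_le_const (a := 0) (b := 1) (C := K)
    (f := fun t => ‖fderiv ℝ (F ∘ γ) t 1‖) fun t ht => by
      rw [uIoc_of_le zero_le_one] at ht
      simpa using hK t (Ioc_subset_Icc_self ht)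
  simpa using (le_abs_self _).trans this

theorem norm_sub_le_of_indDist_lt (hF : ContDiff ℝ ∞ F) {χ : (Fin n → ℝ) → ℝ}
    (hχ : ContDiff ℝ ∞ χ) {C : ℝ} (hC0 : 0 ≤ C)
    (hC : ∀ x v, ‖fderiv ℝ χ x v‖ ≤ C * ‖fderiv ℝ F x v‖) {x y : Fin n → ℝ} {δ : ℝ}
    (h : indDist F x y < δ) : ‖χ y - χ x‖ ≤ C * δ := by
  have hne : {L | ∃ γ : ℝ → Fin n → ℝ, ContDiff ℝ 1 γ ∧ γ 0 = x ∧ γ 1 = y ∧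
      L = ∫ t in (0:ℝ)..1, ‖fderiv ℝ (F ∘ γ) t 1‖}.Nonempty :=
    ⟨_, fun t => x + t • (y - x), by fun_prop, by simp, by simp, rfl⟩
  obtain ⟨L, ⟨γ, hγ, rfl, rfl, rfl⟩, hL⟩ := exists_lt_of_csInf_lt hne h
  have hγd : Differentiable ℝ γ := hγ.differentiable (by simp)
  have hFd : Differentiable ℝ F := hF.differentiable (by simp)
  have hχd : Differentiable ℝ χ := hχ.differentiable (by simp)
  have hχγ : ContDiff ℝ 1 (χ ∘ γ) := (hχ.of_le (by simp)).comp hγ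
  have hFγ : ContDiff ℝ 1 (F ∘ γ) := (hF.of_le (by simp)).comp hγ
  have h1 : ∫ t in (0:ℝ)..1, deriv (χ ∘ γ) t = (χ ∘ γ) 1 - (χ ∘ γ) 0 :=
    intervalIntegral.integral_deriv_eq_sub (fun t _ => hχγ.differentiable (by simp) t)
      ((hχγ.continuous_deriv (by simp)).intervalIntegrable _ _)
  change ‖(χ ∘ γ) 1 - (χ ∘ γ) 0‖ ≤ _
  rw [← h1]
  calc _ ≤ ∫ t in (0:ℝ)..1, C * ‖fderiv ℝ (F ∘ γ) t 1‖ := by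
        refine intervalIntegral.norm_integral_le_of_norm_le zero_le_one ?_ ?_
        · refine Eventually.of_forall fun t _ => ?_
          rw [← fderiv_apply_one_eq_deriv, fderiv_comp t (hχd _) (hγd t),
            fderiv_comp t (hFd _) (hγd t)]
          exact hC _ _
        · exact (continuous_const.mul (((hFγ.continuous_fderiv (by simp)).clm_apply
            continuous_const).norm)).intervalIntegrable _ _
    _ ≤ C * δ := by
        rw [intervalIntegral.integral_const_mul]
        gcongr

theorem exists_forall_dist_lt_of_indDist_lt (hF : ContDiff ℝ ∞ F)
    (himm : ∀ x v, fderiv ℝ F x v = 0 → v = 0) (x : Fin n → ℝ) {ε : ℝ} (hε : 0 < ε) :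
    ∃ δ > 0, ∀ y, indDist F y x < δ → dist y x < ε := by
  let χ : ContDiffBump x := ⟨ε / 2, ε, by positivity, by linarith⟩
  obtain ⟨C, hC0, hC⟩ := exists_norm_fderiv_le_of_hasCompactSupport hF himm (χ := χ) χ.contDiff
    χ.hasCompactSupport
  refine ⟨1 / (C + 1), by positivity, fun y hy => ?_⟩
  have h := norm_sub_le_of_indDist_lt hF χ.contDiff hC0 hC hy
  have h1 : C * (1 / (C + 1)) < 1 := by
    rw [mul_one_div, div_lt_one (by positivity)]
    linarith
  by_contra! hd
  rw [χ.zero_of_le_dist hd, χ.one_of_mem_closedBall (by simp [χ]; positivity)] at h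
  norm_num at h h1
  linarith

theorem tendsto_of_indDist (hF : ContDiff ℝ ∞ F)
    (himm : ∀ x v, fderiv ℝ F x v = 0 → v = 0) {s : ℕ → Fin n → ℝ} {x : Fin n → ℝ}
    (h : ∀ ε > 0, ∃ N, ∀ p ≥ N, indDist F (s p) x < ε) : Tendsto s atTop (𝓝 x) := by
  refine Metric.tendsto_atTop.2 fun ε hε => ?_
  obtain ⟨δ, hδ, hd⟩ := exists_forall_dist_lt_of_indDist_lt hF himm x hε
  obtain ⟨N, hN⟩ := h δ hδ
  exact ⟨N, fun p hp => hd _ (hN p hp)⟩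

end IntrinsicDistance

section PathLifting

open scoped Topology

open Filter Set

theorem IsLocalHomeomorph.exists_lift_of_lift {E X : Type*} [TopologicalSpace E]
    [TopologicalSpace X] {p : E → X} {r : ℝ → X} (hr : Continuous r)
    {q : OpenPartialHomeomorph E X} (hq : p = q) {Γ : ℝ → E} {t₁ t₂ : ℝ} (h0 : 0 ≤ t₁)
    (h12 : t₁ ≤ t₂) (hc : ContinuousOn Γ (Icc 0 t₁)) (hl : ∀ t ∈ Icc 0 t₁, p (Γ t) = r t)
    (hs : Γ t₁ ∈ q.source) (ht : ∀ t ∈ Icc t₁ t₂, r t ∈ q.target) :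
    ∃ Γ' : ℝ → E, ContinuousOn Γ' (Icc 0 t₂) ∧ Γ' 0 = Γ 0 ∧ ∀ t ∈ Icc 0 t₂, p (Γ' t) = r t := by
  have hcq : ContinuousOn (fun t => q.symm (r t)) (Icc t₁ t₂) :=
    q.continuousOn_symm.comp hr.continuousOn ht
  have hj : Γ t₁ = q.symm (r t₁) := by
    rw [← hl t₁ ⟨h0, le_rfl⟩, hq, q.left_inv hs]
  set Γ' : ℝ → E := fun t => if t ≤ t₁ then Γ t else q.symm (r t) with hΓ'
  have e1 : EqOn Γ' Γ (Icc 0 t₁) := fun t ht => if_pos ht.2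
  have e2 : EqOn Γ' (fun t => q.symm (r t)) (Icc t₁ t₂) := fun t ht => by
    rcases ht.1.eq_or_lt with rfl | hlt
    · rw [hΓ']
      simp only [le_refl, if_true]
      exact hj
    · exact if_neg hlt.not_ge
  refine ⟨Γ', ?_, e1 ⟨le_rfl, h0⟩, fun t htt => ?_⟩
  · rw [← Icc_union_Icc_eq_Icc h0 h12]
    exact (hc.congr e1).union_of_isClosed (hcq.congr e2) isClosed_Icc isClosed_Icc
  · rcases le_total t t₁ with h | h
    · rw [e1 ⟨htt.1, h⟩, hl t ⟨htt.1, h⟩]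
    · rw [e2 ⟨h, htt.2⟩, hq]
      exact q.right_inv (ht t ⟨h, htt.2⟩)

theorem IsLocalHomeomorph.exists_lift {E X : Type*} [TopologicalSpace E] [T2Space E]
    [TopologicalSpace X] [T2Space X] {p : E → X} (hp : IsLocalHomeomorph p) {r : ℝ → X}
    (hr : Continuous r) {e : E} (he : p e = r 0)
    (hlim : ∀ T ∈ Ioc (0 : ℝ) 1, ∀ Γ : ℝ → E, ContinuousOn Γ (Ico 0 T) →
      (∀ t ∈ Ico 0 T, p (Γ t) = r t) → ∃ (x : E) (u : ℕ → ℝ), (∀ k, u k ∈ Ico 0 T) ∧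
        Tendsto u atTop (𝓝 T) ∧ Tendsto (fun k => Γ (u k)) atTop (𝓝 x)) :
    ∃ Γ : ℝ → E, ContinuousOn Γ (Icc 0 1) ∧ Γ 0 = e ∧ ∀ t ∈ Icc (0 : ℝ) 1, p (Γ t) = r t := by
  set S : Set ℝ := {T | ∃ Γ : ℝ → E, ContinuousOn Γ (Icc 0 T) ∧ Γ 0 = e ∧
    ∀ t ∈ Icc 0 T, p (Γ t) = r t} with hS
  have hdown : ∀ T ∈ S, ∀ T' ≤ T, T' ∈ S := fun T ⟨Γ, hc, h0, hl⟩ T' hT' =>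
    ⟨Γ, hc.mono (Icc_subset_Icc_right hT'), h0, fun t ht => hl t ⟨ht.1, ht.2.trans hT'⟩⟩
  have h0S : (0 : ℝ) ∈ S := ⟨fun _ => e, continuousOn_const, rfl, fun t ht => by
    rw [he, le_antisymm ht.1 ht.2]⟩
  have hclosed : ∀ T ∈ Ioc (0 : ℝ) 1, (∀ t ∈ Ico 0 T, t ∈ S) → T ∈ S := fun T hT hTS => by
    have : Nonempty E := ⟨e⟩
    choose! G hG hG0 hGl using hTS
    have hagree : ∀ t ∈ Ico 0 T, EqOn (fun s => G s s) (G t) (Icc 0 t) := fun t ht s hs => by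
      have hsT : s ∈ Ico 0 T := ⟨hs.1, hs.2.trans_lt ht.2⟩
      refine IsSeparatedMap.eqOn_of_comp_eqOn (p := p) (T2Space.isSeparatedMap p)
        hp.isLocallyInjective isPreconnected_Icc (hG s hsT)
        ((hG t ht).mono (Icc_subset_Icc_right hs.2)) (fun w hw => ?_) (a := 0) ⟨le_rfl, hs.1⟩
        ((hG0 s hsT).trans (hG0 t ht).symm) ⟨hs.1, le_rfl⟩
      exact (hGl s hsT w hw).trans (hGl t ht w ⟨hw.1, hw.2.trans hs.2⟩).symm
    have hcont : ContinuousOn (fun s => G s s) (Ico 0 T) := fun s hs => by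
      obtain ⟨t, hst, htT⟩ := exists_between hs.2
      have ht : t ∈ Ico 0 T := ⟨hs.1.trans hst.le, htT⟩
      refine (((hG t ht).congr (hagree t ht)) s ⟨hs.1, hst.le⟩).mono_of_mem_nhdsWithin ?_
      refine mem_nhdsWithin.2 ⟨Iio t, isOpen_Iio, hst, fun w hw => ⟨hw.2.1, hw.1.le⟩⟩
    obtain ⟨x, u, hu, huT, hux⟩ := hlim T hT _ hcont fun t ht => hGl t ht t ⟨ht.1, le_rfl⟩
    have hx : p x = r T := by
      refine tendsto_nhds_unique ((hp.continuous.tendsto x).comp hux) ?_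
      refine ((hr.tendsto T).comp huT).congr fun k => ?_
      exact (hGl (u k) (hu k) (u k) ⟨(hu k).1, le_rfl⟩).symm
    obtain ⟨q, hxq, hq⟩ := hp x
    have hTt : r T ∈ q.target := by
      rw [← hx, hq]
      exact q.map_source hxq
    obtain ⟨l, hl, hlt⟩ := mem_nhds_iff_exists_Ioo_subset.1
      ((q.open_target.preimage hr).mem_nhds hTt)
    obtain ⟨k, hk1, hk2⟩ := ((hux.eventually (q.open_source.mem_nhds hxq)).and
      (huT.eventually (lt_mem_nhds hlt.1.1))).exists
    obtain ⟨Γ', h1, h2, h3⟩ := IsLocalHomeomorph.exists_lift_of_lift hr hq (hu k).1 (hu k).2.le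
      (hG _ (hu k)) (hGl _ (hu k)) hk1
      fun t ht => hlt.2 ⟨hk2.trans_le ht.1, ht.2.trans_lt hlt.1.2⟩
    exact ⟨Γ', h1, h2.trans (hG0 _ (hu k)), h3⟩
  have hbdd : BddAbove (S ∩ Icc 0 1) := ⟨1, fun t ht => ht.2.2⟩
  have hne : (S ∩ Icc 0 1).Nonempty := ⟨0, h0S, le_rfl, zero_le_one⟩
  set T := sSup (S ∩ Icc 0 1) with hT
  have hT0 : 0 ≤ T := le_csSup hbdd ⟨h0S, le_rfl, zero_le_one⟩
  have hT1 : T ≤ 1 := csSup_le hne fun t ht => ht.2.2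
  have hTS : T ∈ S := by
    rcases hT0.eq_or_lt with h | h
    · rwa [← h]
    · refine hclosed T ⟨h, hT1⟩ fun t ht => ?_
      obtain ⟨t', ht', hlt⟩ := exists_lt_of_lt_csSup hne ht.2
      exact hdown t' ht'.1 t hlt.le
  rcases hT1.eq_or_lt with h1 | h1
  · rwa [h1] at hTS
  exfalso
  obtain ⟨Γ, hc, h0, hl⟩ := hTS
  obtain ⟨q, hxq, hq⟩ := hp (Γ T)
  have hTt : r T ∈ q.target := by
    rw [← hl T ⟨hT0, le_rfl⟩, hq]
    exact q.map_source hxq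
  obtain ⟨a, b, hab, hsub⟩ := mem_nhds_iff_exists_Ioo_subset.1
    ((q.open_target.preimage hr).mem_nhds hTt)
  obtain ⟨T', hT', hT'b⟩ := exists_between (lt_min hab.2 h1)
  obtain ⟨Γ', h1', h2', h3'⟩ := IsLocalHomeomorph.exists_lift_of_lift hr hq hT0 hT'.le hc hl hxq
    fun t ht => hsub ⟨hab.1.trans_le ht.1, ht.2.trans_lt (hT'b.trans_le (min_le_left _ _))⟩
  have : T' ≤ T := le_csSup hbdd ⟨⟨Γ', h1', h2'.trans h0, h3'⟩, hT0.trans hT'.le,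
    (hT'b.trans_le (min_le_right _ _)).le⟩
  exact absurd hT' this.not_gt

end PathLifting

section DevelopingMap

open scoped ContDiff Topology unitInterval

open Filter Set

variable {n : ℕ} {F : (Fin n → ℝ) → EuclideanSpace ℝ (Fin (n + 1))}
  {W : Type*} [NormedAddCommGroup W] [NormedSpace ℝ W] {P : (Fin n → ℝ) → W}

theorem isLocalHomeomorph_of_hasFDerivAt_equiv (hP : ContDiff ℝ ∞ P)
    (hL : ∀ x, ∃ L : (Fin n → ℝ) ≃L[ℝ] W, HasFDerivAt P (L : (Fin n → ℝ) →L[ℝ] W) x) :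
    IsLocalHomeomorph P := by
  refine IsLocalHomeomorph.mk P fun x => ?_
  obtain ⟨L, hL⟩ := hL x
  exact ⟨(hP.contDiffAt).toOpenPartialHomeomorph P hL (by simp),
    ContDiffAt.mem_toOpenPartialHomeomorph_source (hP.contDiffAt) hL (by simp), fun y _ => rfl⟩

theorem contDiff_of_comp_contDiff (hP : ContDiff ℝ ∞ P)
    (hL : ∀ x, ∃ L : (Fin n → ℝ) ≃L[ℝ] W, HasFDerivAt P (L : (Fin n → ℝ) →L[ℝ] W) x)
    {μ : ℝ → Fin n → ℝ} (hμ : Continuous μ) (hPμ : ContDiff ℝ 1 (P ∘ μ)) : ContDiff ℝ 1 μ := by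
  refine contDiff_iff_contDiffAt.2 fun t => ?_
  obtain ⟨q, hq, hPq⟩ := isLocalHomeomorph_of_hasFDerivAt_equiv hP hL (μ t)
  obtain ⟨L, hLt⟩ := hL (μ t)
  have hinv : q.symm (q (μ t)) = μ t := q.left_inv hq
  have h1 : ContDiffAt ℝ 1 q.symm (q (μ t)) :=
    q.contDiffAt_symm (q.map_source hq) (by rw [hinv, ← hPq]; exact hLt)
      (by rw [hinv, ← hPq]; exact (hP.of_le (by simp)).contDiffAt)
  rw [← hPq] at h1
  have h2 : ContDiffAt ℝ 1 (q.symm ∘ (P ∘ μ)) t := h1.comp t hPμ.contDiffAt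
  refine h2.congr_of_eventuallyEq ?_
  filter_upwards [(hμ.tendsto t).eventually (q.open_source.mem_nhds hq)] with s hs
  simp [hPq, q.left_inv hs]

theorem exists_indDist_le_of_lift (hF : ContDiff ℝ ∞ F) (hP : ContDiff ℝ ∞ P)
    (hL : ∀ x, ∃ L : (Fin n → ℝ) ≃L[ℝ] W, HasFDerivAt P (L : (Fin n → ℝ) →L[ℝ] W) x)
    {C : ℝ} (hC0 : 0 ≤ C) (hC : ∀ x v, ‖fderiv ℝ F x v‖ ≤ C * ‖fderiv ℝ P x v‖) (p w : W) :
    ∃ K : ℝ, 0 ≤ K ∧ ∀ (T : ℝ) (Γ : ℝ → Fin n → ℝ), ContinuousOn Γ (Ico 0 T) →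
      (∀ t ∈ Ico 0 T, P (Γ t) = p + t • w) → ∀ s ∈ Ico 0 T, ∀ t ∈ Ico 0 T,
      indDist F (Γ s) (Γ t) ≤ K * |t - s| := by
  have hst : ContDiff ℝ 1 smoothTransition := smoothTransition.contDiff
  obtain ⟨M, hM⟩ := (isCompact_Icc (a := (0 : ℝ)) (b := 1)).exists_bound_of_continuousOn
    (hst.continuous_deriv le_rfl).continuousOn
  have hM0 : 0 ≤ M := (norm_nonneg _).trans (hM 0 ⟨le_rfl, zero_le_one⟩)
  refine ⟨C * (M * ‖w‖), by positivity, fun T Γ hc hl s hs t ht => ?_⟩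
  set g : ℝ → ℝ := fun τ => s + smoothTransition τ * (t - s) with hg
  have hg_mem : ∀ τ, g τ ∈ Ico 0 T := fun τ => by
    have := (convex_Ico (0 : ℝ) T).add_smul_sub_mem hs ht
      ⟨smoothTransition.nonneg τ, smoothTransition.le_one τ⟩
    simpa [hg] using this
  have hg_diff : ContDiff ℝ 1 g := contDiff_const.add (hst.mul contDiff_const)
  have hμc : Continuous (Γ ∘ g) := hc.comp_continuous hg_diff.continuous hg_mem
  have hPμ : P ∘ (Γ ∘ g) = fun τ => p + g τ • w := funext fun τ => hl _ (hg_mem τ)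
  have hPμd : ContDiff ℝ 1 (P ∘ (Γ ∘ g)) := by
    rw [hPμ]
    exact contDiff_const.add (hg_diff.smul contDiff_const)
  have hμ := contDiff_of_comp_contDiff hP hL hμc hPμd
  have h := indDist_le_of_norm_fderiv_le (F := F) hμ (K := C * (M * ‖w‖) * |t - s|) fun τ hτ => ?_
  · simpa [hg] using h
  have hμd := hμ.differentiable (by simp) τ
  have hd : HasDerivAt (P ∘ (Γ ∘ g)) ((deriv smoothTransition τ * (t - s)) • w) τ := by
    rw [hPμ]
    exact ((((hst.differentiable (by simp) τ).hasDerivAt.mul_const (t - s)).const_add s).smul_const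
      w).const_add p
  have hd2 : fderiv ℝ P ((Γ ∘ g) τ) (fderiv ℝ (Γ ∘ g) τ 1) =
      (deriv smoothTransition τ * (t - s)) • w := by
    rw [← hd.deriv, ← fderiv_apply_one_eq_deriv,
      fderiv_comp τ (hP.differentiable (by simp) _) hμd]
    rfl
  rw [fderiv_comp τ (hF.differentiable (by simp) _) hμd]
  refine (hC ((Γ ∘ g) τ) (fderiv ℝ (Γ ∘ g) τ 1)).trans ?_
  rw [hd2, norm_smul, norm_mul, Real.norm_eq_abs (t - s)]
  calc _ ≤ C * (M * |t - s| * ‖w‖) := by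
        gcongr
        exact hM τ hτ
    _ = _ := by ring

theorem exists_lift_line (hF : ContDiff ℝ ∞ F) (himm : ∀ x v, fderiv ℝ F x v = 0 → v = 0)
    (hcomplete : ∀ s : ℕ → Fin n → ℝ,
      (∀ ε > 0, ∃ N, ∀ p ≥ N, ∀ q ≥ N, indDist F (s p) (s q) < ε) →
      ∃ x, ∀ ε > 0, ∃ N, ∀ p ≥ N, indDist F (s p) x < ε) (hP : ContDiff ℝ ∞ P)
    (hL : ∀ x, ∃ L : (Fin n → ℝ) ≃L[ℝ] W, HasFDerivAt P (L : (Fin n → ℝ) →L[ℝ] W) x)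
    {C : ℝ} (hC0 : 0 ≤ C) (hC : ∀ x v, ‖fderiv ℝ F x v‖ ≤ C * ‖fderiv ℝ P x v‖)
    (e : Fin n → ℝ) (w : W) :
    ∃ Γ : ℝ → Fin n → ℝ, ContinuousOn Γ (Icc 0 1) ∧ Γ 0 = e ∧
      ∀ t ∈ Icc (0 : ℝ) 1, P (Γ t) = P e + t • w := by
  refine (isLocalHomeomorph_of_hasFDerivAt_equiv hP hL).exists_lift (r := fun t => P e + t • w)
    (by fun_prop) (by simp) fun T hT Γ hc hl => ?_
  obtain ⟨K, hK0, hK⟩ := exists_indDist_le_of_lift hF hP hL hC0 hC (P e) w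
  have hu : Tendsto (fun k : ℕ => T - T * (1 / ((k : ℝ) + 1))) atTop (𝓝 T) := by
    simpa using (tendsto_one_div_add_atTop_nhds_zero_nat.const_mul T).const_sub T
  set u : ℕ → ℝ := fun k => T - T * (1 / ((k : ℝ) + 1)) with hud
  have hmem : ∀ k, u k ∈ Ico 0 T := fun k => by
    have h0 : 0 < 1 / ((k : ℝ) + 1) := by positivity
    have h1 : 1 / ((k : ℝ) + 1) ≤ 1 := by
      rw [div_le_one (by positivity)]
      linarith [(k.cast_nonneg : (0 : ℝ) ≤ k)]
    have hT0 := hT.1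
    constructor
    · change 0 ≤ T - T * _
      nlinarith
    · change T - T * _ < T
      nlinarith
  obtain ⟨x, hx⟩ := hcomplete (fun k => Γ (u k)) fun ε hε => by
    obtain ⟨N, hN⟩ := Metric.cauchySeq_iff.1 hu.cauchySeq (ε / (K + 1)) (by positivity)
    refine ⟨N, fun p hp q hq => (hK T Γ hc hl _ (hmem p) _ (hmem q)).trans_lt ?_⟩
    have h1 := hN q hq p hp
    rw [Real.dist_eq, lt_div_iff₀ (by positivity)] at h1
    nlinarith [abs_nonneg (u q - u p)]
  exact ⟨x, u, hmem, hu, tendsto_of_indDist hF himm hx⟩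

theorem exists_continuous_inverse (hF : ContDiff ℝ ∞ F)
    (himm : ∀ x v, fderiv ℝ F x v = 0 → v = 0)
    (hcomplete : ∀ s : ℕ → Fin n → ℝ,
      (∀ ε > 0, ∃ N, ∀ p ≥ N, ∀ q ≥ N, indDist F (s p) (s q) < ε) →
      ∃ x, ∀ ε > 0, ∃ N, ∀ p ≥ N, indDist F (s p) x < ε) (hP : ContDiff ℝ ∞ P)
    (hL : ∀ x, ∃ L : (Fin n → ℝ) ≃L[ℝ] W, HasFDerivAt P (L : (Fin n → ℝ) →L[ℝ] W) x)
    {C : ℝ} (hC0 : 0 ≤ C) (hC : ∀ x v, ‖fderiv ℝ F x v‖ ≤ C * ‖fderiv ℝ P x v‖) :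
    ∃ s : W → Fin n → ℝ, Continuous s ∧ (∀ y, P (s y) = y) ∧ ∀ x, s (P x) = x := by
  have hloc := isLocalHomeomorph_of_hasFDerivAt_equiv hP hL
  have hsep : IsSeparatedMap P := T2Space.isSeparatedMap P
  choose Γ hΓc hΓ0 hΓl using fun w =>
    exists_lift_line hF himm hcomplete hP hL hC0 hC (0 : Fin n → ℝ) w
  have hcont : Continuous fun z : I × W => Γ (z.2 - P 0) z.1 := by
    refine hloc.continuous_lift hsep ⟨fun z : I × W => P 0 + (z.1 : ℝ) • (z.2 - P 0), by fun_prop⟩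
      (funext fun z => hΓl _ _ z.1.2) ?_ fun a => ?_
    · simp only [Set.Icc.coe_zero, hΓ0]
      exact continuous_const
    · exact (hΓc (a - P 0)).comp_continuous continuous_subtype_val fun t => t.2
  have hs : Continuous fun y : W => Γ (y - P 0) 1 := by
    exact hcont.comp (Continuous.prodMk_right (1 : I))
  have hsl : ∀ y, P (Γ (y - P 0) 1) = y := fun y => by
    simp [hΓl (y - P 0) 1 ⟨zero_le_one, le_rfl⟩]
  refine ⟨_, hs, hsl, fun x => ?_⟩
  refine congrFun (hsep.eq_of_comp_eq hloc.isLocallyInjective (hs.comp hP.continuous)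
    continuous_id (funext fun x => hsl _) 0 ?_) x
  change Γ (P 0 - P 0) 1 = 0
  refine Eq.trans ?_ (hΓ0 (P 0 - P 0))
  refine hsep.constOn_of_comp hloc.isLocallyInjective isPreconnected_Icc (hΓc _) ?_
    ⟨zero_le_one, le_rfl⟩ ⟨le_rfl, zero_le_one⟩
  intro a ha b hb
  rw [hΓl _ _ ha, hΓl _ _ hb]
  simp

end DevelopingMap

section Hyperplane

open scoped ContDiff

variable {n : ℕ} {F ν : (Fin n → ℝ) → EuclideanSpace ℝ (Fin (n + 1))}

theorem fderiv_eq_sum_pdv (F : (Fin n → ℝ) → EuclideanSpace ℝ (Fin (n + 1)))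
    (x v : Fin n → ℝ) : fderiv ℝ F x v = ∑ i, v i • pdv i F x := by
  conv_lhs => rw [pi_eq_sum_univ' v]
  simp [pdv, map_sum]

theorem eq_zero_of_fderiv_eq_zero (himm : ∀ x, (gmet F x).det ≠ 0) (x v : Fin n → ℝ)
    (h : fderiv ℝ F x v = 0) : v = 0 := by
  refine Matrix.eq_zero_of_mulVec_eq_zero (himm x) (funext fun i => ?_)
  have h1 : ⟪pdv i F x, fderiv ℝ F x v⟫ = 0 := by rw [h, inner_zero_right]
  rw [fderiv_eq_sum_pdv, inner_sum] at h1
  simpa [Matrix.mulVec, dotProduct, gmet, inner_smul_right, mul_comm] using h1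

theorem inner_normal_fderiv (horth : ∀ x i, ⟪ν x, pdv i F x⟫ = 0) (x v : Fin n → ℝ) :
    ⟪ν x, fderiv ℝ F x v⟫ = 0 := by
  rw [fderiv_eq_sum_pdv, inner_sum]
  simp [inner_smul_right, horth]

theorem cos_pos_and_lt_of_arccos_lt {z Λ : ℝ} (hz1 : -1 ≤ z) (hz2 : z ≤ 1)
    (hΛ : Λ < π / 2) (h : Real.arccos z < Λ) : 0 < Real.cos Λ ∧ Real.cos Λ < z := by
  have h0 := Real.arccos_nonneg z
  refine ⟨Real.cos_pos_of_mem_Ioo ⟨by linarith [Real.pi_pos], hΛ⟩, ?_⟩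
  have := Real.cos_lt_cos_of_nonneg_of_le_pi_div_two h0 hΛ.le h
  rwa [Real.cos_arccos hz1 hz2] at this

section Graph

variable {E : Type*} [NormedAddCommGroup E] [InnerProductSpace ℝ E]
  {y : E}

theorem eq_orthogonalProjectionOnto_add (hy : ‖y‖ = 1) (u : E) :
    u = ((ℝ ∙ y)ᗮ.orthogonalProjectionOnto u : E) + ⟪y, u⟫ • y := by
  rw [← Submodule.starProjection_apply, Submodule.starProjection_orthogonal_val,
    Submodule.starProjection_unit_singleton ℝ hy, sub_add_cancel]

theorem norm_le_mul_norm_orthogonalProjectionOnto (hy : ‖y‖ = 1) {a u : E} (ha : ‖a‖ = 1) {θ₀ : ℝ}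
    (hθ₀ : 0 < θ₀) (hθ : θ₀ ≤ ⟪y, a⟫) (hau : ⟪a, u⟫ = 0) :
    ‖u‖ ≤ (1 + 1 / θ₀) * ‖(ℝ ∙ y)ᗮ.orthogonalProjectionOnto u‖ := by
  set q := (ℝ ∙ y)ᗮ.orthogonalProjectionOnto u with hq
  have hu := eq_orthogonalProjectionOnto_add hy u
  rw [← hq] at hu
  have h1 : ⟪a, (q : E)⟫ + ⟪y, u⟫ * ⟪y, a⟫ = 0 := by
    rw [real_inner_comm a y, ← inner_smul_right, ← inner_add_right, ← hu, hau]
  have h2 : |⟪a, (q : E)⟫| ≤ ‖q‖ := by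
    simpa [ha] using abs_real_inner_le_norm a (q : E)
  have h3 : |⟪y, u⟫| * θ₀ ≤ ‖q‖ := by
    refine (mul_le_mul_of_nonneg_left hθ (abs_nonneg _)).trans ?_
    rw [← abs_of_pos (hθ₀.trans_le hθ), ← abs_mul,
      eq_neg_of_add_eq_zero_right h1, abs_neg]
    exact h2
  have h4 : |⟪y, u⟫| ≤ ‖q‖ / θ₀ := (le_div_iff₀ hθ₀).2 h3
  calc ‖u‖ = ‖(q : E) + ⟪y, u⟫ • y‖ := by rw [← hu]
    _ ≤ ‖q‖ + |⟪y, u⟫| := by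
      refine (norm_add_le _ _).trans (le_of_eq ?_)
      rw [norm_smul, hy, mul_one, Real.norm_eq_abs, Submodule.coe_norm]
    _ ≤ ‖q‖ + ‖q‖ / θ₀ := by gcongr
    _ = _ := by ring

end Graph

/-- A complete immersion whose unit normal stays in a compact part of the open hemisphere around
`y` is a graph over the hyperplane orthogonal to `y`. -/
theorem exists_continuous_inverse_of_normal (hF : ContDiff ℝ ∞ F) (hunit : ∀ x, ‖ν x‖ = 1)
    (horth : ∀ x i, ⟪ν x, pdv i F x⟫ = 0) (himm : ∀ x, (gmet F x).det ≠ 0)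
    (hcomplete : ∀ s : ℕ → Fin n → ℝ,
      (∀ ε > 0, ∃ N, ∀ p ≥ N, ∀ q ≥ N, indDist F (s p) (s q) < ε) →
      ∃ x, ∀ ε > 0, ∃ N, ∀ p ≥ N, indDist F (s p) x < ε)
    {y : EuclideanSpace ℝ (Fin (n + 1))} (hy : ‖y‖ = 1) {θ₀ : ℝ} (hθ₀ : 0 < θ₀)
    (hθ : ∀ x, θ₀ ≤ ⟪y, ν x⟫) :
    ∃ s : (ℝ ∙ y)ᗮ → Fin n → ℝ, Continuous s ∧
      (∀ w, (ℝ ∙ y)ᗮ.orthogonalProjectionOnto (F (s w)) = w) ∧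
      ∀ x, s ((ℝ ∙ y)ᗮ.orthogonalProjectionOnto (F x)) = x := by
  have hy0 : y ≠ 0 := by
    rintro rfl
    simp at hy
  have hC0 : 0 ≤ 1 + 1 / θ₀ := by positivity
  have hd (x) : HasFDerivAt (fun x => (ℝ ∙ y)ᗮ.orthogonalProjectionOnto (F x))
      (((ℝ ∙ y)ᗮ.orthogonalProjectionOnto).comp (fderiv ℝ F x)) x :=
    ((ℝ ∙ y)ᗮ.orthogonalProjectionOnto).hasFDerivAt.comp x
      (hF.differentiable (by simp) x).hasFDerivAt
  have hC (x v) : ‖fderiv ℝ F x v‖ ≤ (1 + 1 / θ₀) *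
      ‖fderiv ℝ (fun x => (ℝ ∙ y)ᗮ.orthogonalProjectionOnto (F x)) x v‖ := by
    rw [(hd x).fderiv]
    exact norm_le_mul_norm_orthogonalProjectionOnto hy (hunit x) hθ₀ (hθ x)
      (inner_normal_fderiv horth x v)
  refine exists_continuous_inverse hF (eq_zero_of_fderiv_eq_zero himm) hcomplete
    (((ℝ ∙ y)ᗮ.orthogonalProjectionOnto).contDiff.comp hF) (fun x => ?_) hC0 hC
  have hinj : Function.Injective
      (((ℝ ∙ y)ᗮ.orthogonalProjectionOnto).comp (fderiv ℝ F x)).toLinearMap := by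
    refine (injective_iff_map_eq_zero _).2 fun v hv => eq_zero_of_fderiv_eq_zero himm x v ?_
    have h := hC x v
    rw [(hd x).fderiv] at h
    rw [ContinuousLinearMap.coe_coe] at hv
    rw [hv, norm_zero, mul_zero] at h
    exact norm_le_zero_iff.1 h
  have : Fact (Module.finrank ℝ (EuclideanSpace ℝ (Fin (n + 1))) = n + 1) := ⟨by simp⟩
  have hrank : Module.finrank ℝ (Fin n → ℝ) = Module.finrank ℝ (ℝ ∙ y)ᗮ := by
    rw [Submodule.finrank_orthogonal_span_singleton (n := n) hy0]
    simp
  refine ⟨(LinearEquiv.ofInjectiveOfFinrankEq _ hinj hrank).toContinuousLinearEquiv, ?_⟩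
  exact hd x

theorem range_eq_of_normal_const (hF : ContDiff ℝ ∞ F)
    {a y : EuclideanSpace ℝ (Fin (n + 1))} (hya : ⟪y, a⟫ ≠ 0) (hy : ‖y‖ = 1)
    (horth : ∀ x v, ⟪a, fderiv ℝ F x v⟫ = 0)
    (hsurj : Function.Surjective fun x => (ℝ ∙ y)ᗮ.orthogonalProjectionOnto (F x)) :
    Set.range F = {p | ⟪p, a⟫ = ⟪F 0, a⟫} := by
  have hconst (x) : ⟪a, F x⟫ = ⟪a, F 0⟫ := by
    refine is_const_of_fderiv_eq_zero (𝕜 := ℝ) (f := fun x => ⟪a, F x⟫)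
      (((innerSL ℝ a).contDiff.comp hF).differentiable (by simp)) (fun x => ?_) x 0
    have h : HasFDerivAt (fun x => ⟪a, F x⟫) ((innerSL ℝ a).comp (fderiv ℝ F x)) x :=
      (innerSL ℝ a).hasFDerivAt.comp x (hF.differentiable (by simp) x).hasFDerivAt
    rw [h.fderiv]
    ext v
    simp [horth]
  ext p
  constructor
  · rintro ⟨x, rfl⟩
    change ⟪F x, a⟫ = _
    rw [real_inner_comm, hconst, real_inner_comm]
  · intro hp
    obtain ⟨x, hx⟩ := hsurj ((ℝ ∙ y)ᗮ.orthogonalProjectionOnto p)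
    refine ⟨x, sub_eq_zero.1 ?_⟩
    have h1 := eq_orthogonalProjectionOnto_add hy (F x - p)
    rw [map_sub, sub_eq_zero.2 hx, ZeroMemClass.coe_zero, zero_add] at h1
    have h2 : ⟪F x - p, a⟫ = 0 := by
      rw [inner_sub_left, hp, real_inner_comm, hconst, real_inner_comm, sub_self]
    rw [h1, real_inner_smul_left] at h2
    rw [h1, (mul_eq_zero.1 h2).resolve_right hya, zero_smul]

theorem isCompact_setOf_sum_sq_le {W : Type*} [NormedAddCommGroup W] [InnerProductSpace ℝ W]
    [FiniteDimensional ℝ W] (hF : Continuous F) (L : EuclideanSpace ℝ (Fin (n + 1)) →L[ℝ] W)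
    {s : W → Fin n → ℝ} (hs : Continuous s) (hsL : ∀ x, s (L (F x)) = x) (ρ : ℝ) :
    IsCompact {x | ∑ b, F x b ^ 2 ≤ ρ} := by
  refine ((isCompact_closedBall (0 : W) (‖L‖ * √ρ)).image hs).of_isClosed_subset
    (isClosed_le (by fun_prop) continuous_const) fun x hx => ⟨L (F x), ?_, hsL x⟩
  rw [mem_closedBall_zero_iff]
  refine (L.le_opNorm _).trans ?_
  gcongr
  rw [EuclideanSpace.norm_eq]
  exact Real.sqrt_le_sqrt (by simpa using hx)

end Hyperplane

/-- Bernstein-type corollary: a complete minimal hypersurface in ℝⁿ⁺¹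
whose Gauss map image lies in a geodesic ball B_Λ(y₀) ⊂ Sⁿ with Λ < π/2 is a hyperplane. -/
theorem minimal_hypersurface_bernstein
    {n : ℕ} (hn : 2 ≤ n)
    (F ν : (Fin n → ℝ) → EuclideanSpace ℝ (Fin (n + 1)))
    (hF : ContDiff ℝ (⊤ : ℕ∞) F) (hν : ContDiff ℝ (⊤ : ℕ∞) ν)
    (hunit : ∀ x, ‖ν x‖ = 1)
    (horth : ∀ x i, ⟪ν x, pdv i F x⟫ = 0)
    (himm : ∀ x, (gmet F x).det ≠ 0)
    (hmin : ∀ x, meanCurv F ν x = 0)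
    (y₀ : EuclideanSpace ℝ (Fin (n + 1))) (hy₀ : ‖y₀‖ = 1)
    (Λ : ℝ) (hΛ : Λ < π / 2)
    (hgauss : ∀ x, Real.arccos ⟪y₀, ν x⟫ < Λ)
    (hcomplete : ∀ s : ℕ → Fin n → ℝ,
      (∀ ε > 0, ∃ N, ∀ p ≥ N, ∀ q ≥ N, indDist F (s p) (s q) < ε) →
      ∃ x, ∀ ε > 0, ∃ N, ∀ p ≥ N, indDist F (s p) x < ε) :
    ∃ a : EuclideanSpace ℝ (Fin (n + 1)), ∃ c : ℝ,
      ‖a‖ = 1 ∧ Set.range F = {p | ⟪p, a⟫ = c} := by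
  have hle (x) : ⟪y₀, ν x⟫ ≤ 1 := by
    simpa [hy₀, hunit x] using real_inner_le_norm y₀ (ν x)
  have hge (x) : -1 ≤ ⟪y₀, ν x⟫ := by
    simpa [hy₀, hunit x] using neg_le_of_abs_le (abs_real_inner_le_norm y₀ (ν x))
  have hcos (x) := cos_pos_and_lt_of_arccos_lt (hge x) (hle x) hΛ (hgauss x)
  have hθ₀ := (hcos 0).1
  obtain ⟨s, hs, hPs, hsP⟩ := exists_continuous_inverse_of_normal hF hunit horth himm hcomplete
    hy₀ hθ₀ fun x => (hcos x).2.le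
  have hνc (x) : ν x = ν 0 := by
    ext b
    exact (isMinimalFrame hF hν hunit horth himm hmin).normal_eq (fun a => y₀ a) hθ₀
      (fun x => (hcos x).2.le.trans_eq (euclidean_inner_eq_sum _ _))
      (fun x => (euclidean_inner_eq_sum _ _).symm.trans_le (hle x))
      (isCompact_setOf_sum_sq_le hF.continuous _ hs hsP) b x 0
  refine ⟨ν 0, _, hunit 0, range_eq_of_normal_const hF (hθ₀.trans (hcos 0).2).ne' hy₀
    (fun x v => ?_) fun w => ⟨s w, hPs w⟩⟩
  rw [← hνc x]
  exact inner_normal_fderiv horth x v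

end
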